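/- arXiv:1605.08198 — 9 statements merged into one kernel-verified Lean document; each statement's English description precedes it below -/
import Mathlib

section
/- Let M be a finitely generated ℤ[C]-module that is torsion-free as an abelian group, has finite rank, and is such that χ_M has integer coefficients. If the constant term μ_M(0) of the minimal polynomial belongs to {−1, 1}, then M is finitely generated as an abelian group. -/
open Polynomial TensorProduct

noncomputable section

/-- The endomorphism `t - 1` of `M`, where the fixed generator `t` of the infinite
cyclic group `C` acts on `M` via the automorphism `e`. -/
def tsub (M : Type) [AddCommGroup M] (e : M ≃ₗ[ℤ] M) : M →ₗ[ℤ] M :=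
  e.toLinearMap - LinearMap.id

/-- `M` is finitely generated as a module over the group ring `ℤ[C]` of the infinite
cyclic group `C`, where the generator `t` acts via the automorphism `e`. -/
def IsCFG (M : Type) [AddCommGroup M] (e : M ≃ₗ[ℤ] M) : Prop :=
  ∃ s : Finset M, Submodule.span ℤ (⋃ n : ℤ, ⇑(e ^ n) '' (s : Set M)) = ⊤

/-- The `ℚ`-linear action `a_M` of the generator `t` on `M ⊗ ℚ`. -/
def aM (M : Type) [AddCommGroup M] (e : M ≃ₗ[ℤ] M) : (ℚ ⊗[ℤ] M) →ₗ[ℚ] ℚ ⊗[ℤ] M :=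
  LinearMap.baseChange ℚ e.toLinearMap

/-- Let `M` be a finitely generated `ℤ[C]`-module, torsion free as an abelian group, of
finite rank, and with integral characteristic polynomial `χ_M`.  If the constant term
`μ_M(0)` of the minimal polynomial lies in `{-1, 1}`, then `M` is finitely generated as
an abelian group. -/
theorem stmt_3 (M : Type) [AddCommGroup M] (e : M ≃ₗ[ℤ] M)
    [NoZeroSMulDivisors ℤ M] [Module.Finite ℚ (ℚ ⊗[ℤ] M)]
    (hfg : IsCFG M e)
    (hchi : ∃ p : Polynomial ℤ, p.map (Int.castRingHom ℚ) = LinearMap.charpoly (aM M e))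
    (hmu : (minpoly ℚ (aM M e)).eval 0 = 1 ∨ (minpoly ℚ (aM M e)).eval 0 = -1) :
    Module.Finite ℤ M := by
  classical
  -- the minimal polynomial is integral
  obtain ⟨p, hp⟩ := hchi
  have hinj : Function.Injective (Int.castRingHom ℚ) := Int.cast_injective
  have hpm : p.Monic := by
    apply Polynomial.monic_of_injective hinj
    rw [hp]
    exact LinearMap.charpoly_monic _
  have hdvd : minpoly ℚ (aM M e) ∣ p.map (algebraMap ℤ ℚ) := by
    have : p.map (algebraMap ℤ ℚ) = LinearMap.charpoly (aM M e) := hp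
    rw [this]
    exact LinearMap.minpoly_dvd_charpoly _
  obtain ⟨q, hq⟩ := IsIntegrallyClosed.eq_map_mul_C_of_dvd ℚ hpm hdvd
  have hint : IsIntegral ℚ (aM M e) := Algebra.IsIntegral.isIntegral _
  have hmonic := minpoly.monic hint
  rw [hmonic.leadingCoeff, C_1, mul_one] at hq
  have hqm : q.Monic := by
    apply Polynomial.monic_of_injective hinj
    have : q.map (Int.castRingHom ℚ) = minpoly ℚ (aM M e) := hq
    rw [this]
    exact hmonic
  -- `q` kills `t` on `M`
  set f : Module.End ℤ M := e.toLinearMap with hf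
  have haM : aM M e = Module.End.baseChangeHom ℤ ℚ M f := rfl
  have hq0 : aeval (aM M e) q = 0 := by
    rw [← Polynomial.aeval_map_algebraMap ℚ, hq]
    exact minpoly.aeval _ _
  have hqf : aeval f q = 0 := by
    rw [haM, Polynomial.aeval_algHom_apply] at hq0
    ext m
    have h1 : (1 : ℚ) ⊗ₜ[ℤ] (aeval f q m) = 0 := by
      have := congrArg (fun g : Module.End ℚ (ℚ ⊗[ℤ] M) => g ((1 : ℚ) ⊗ₜ[ℤ] m)) hq0
      exact this
    have h2 := (IsLocalizedModule.eq_zero_iff (nonZeroDivisors ℤ)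
      (TensorProduct.mk ℤ ℚ M 1)).1 h1
    obtain ⟨c, hc⟩ := h2
    rcases NoZeroSMulDivisors.eq_zero_or_eq_zero_of_smul_eq_zero
      (show (c : ℤ) • (aeval f q m) = 0 from hc) with h | h
    · exact absurd h (nonZeroDivisors.ne_zero c.2)
    · simpa using h
  have hfint : IsIntegral ℤ f := ⟨q, hqm, hqf⟩
  -- constant term
  have hq1 : q.coeff 0 = 1 ∨ q.coeff 0 = -1 := by
    have h : (minpoly ℚ (aM M e)).eval 0 = ((q.coeff 0 : ℤ) : ℚ) := by
      rw [← hq, ← coeff_zero_eq_eval_zero, coeff_map]; rfl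
    rw [h] at hmu
    exact_mod_cast hmu
  set A := Algebra.adjoin ℤ {f} with hA
  have hfA : f ∈ A := Algebra.self_mem_adjoin_singleton ℤ f
  set g : Module.End ℤ M := e.symm.toLinearMap with hg
  have hgf : g * f = 1 := by ext m; simp [hf, hg]
  have hgA : g ∈ A := by
    have h1 : aeval f q.divX ∈ A := Polynomial.aeval_mem_adjoin_singleton ℤ f
    have h2 : f * aeval f q.divX + (q.coeff 0) • (1 : Module.End ℤ M) = 0 := by
      have h3 := hqf
      rw [← X_mul_divX_add q] at h3
      simpa [Algebra.smul_def] using h3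
    have h3 : aeval f q.divX + (q.coeff 0) • g = 0 := by
      have := congrArg (fun x => g * x) h2
      simpa only [mul_add, ← mul_assoc, hgf, one_mul, mul_smul_comm, mul_one, mul_zero] using this
    rcases hq1 with h | h
    · rw [h, one_smul] at h3
      rw [eq_neg_of_add_eq_zero_right h3]
      exact A.neg_mem h1
    · rw [h, neg_smul, one_smul] at h3
      rw [← add_neg_eq_zero.1 h3]
      exact h1
  have hpow : ∀ n : ℤ, ((e ^ n : M ≃ₗ[ℤ] M).toLinearMap : Module.End ℤ M) ∈ A := by
    have hnat : ∀ (u : M ≃ₗ[ℤ] M), (u.toLinearMap : Module.End ℤ M) ∈ A →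
        ∀ n : ℕ, ((u ^ n : M ≃ₗ[ℤ] M).toLinearMap : Module.End ℤ M) ∈ A := by
      intro u hu n
      induction n with
      | zero => exact A.one_mem
      | succ n ih =>
        rw [pow_succ]
        exact A.mul_mem ih hu
    intro n
    obtain ⟨k, rfl | rfl⟩ := n.eq_nat_or_neg
    · rw [zpow_natCast]; exact hnat e hfA k
    · rw [zpow_neg, zpow_natCast, ← inv_pow]; exact hnat e⁻¹ hgA k
  obtain ⟨s, hs⟩ := hfg
  have hfgm := Submodule.FG.map₂ (LinearMap.id : Module.End ℤ M →ₗ[ℤ] M →ₗ[ℤ] M)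
    hfint.fg_adjoin_singleton (Submodule.fg_span (R := ℤ) s.finite_toSet)
  have htop : Submodule.map₂ (LinearMap.id : Module.End ℤ M →ₗ[ℤ] M →ₗ[ℤ] M)
      (Subalgebra.toSubmodule (Algebra.adjoin ℤ {f})) (Submodule.span ℤ (s : Set M)) = ⊤ := by
    rw [eq_top_iff, ← hs, Submodule.span_le]
    intro x hx
    obtain ⟨n, y, hy, rfl⟩ := Set.mem_iUnion.1 hx
    exact Submodule.apply_mem_map₂ (LinearMap.id : Module.End ℤ M →ₗ[ℤ] M →ₗ[ℤ] M)
      (hpow n) (Submodule.subset_span hy)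
  rw [htop] at hfgm
  exact ⟨hfgm⟩
end
end

section
/- Let M be a finitely generated ℤ[C]-module that is torsion-free as an abelian group, has finite rank, has integral characteristic polynomial χ_M, and satisfies M^C = 0. Set n = χ_M(1) ∈ ℤ. Then n^i · M ⊆ M·I^i for every i ≥ 1, where I is the augmentation ideal of ℤ[C]. -/
open Polynomial TensorProduct

noncomputable section

/-- Let `M` be a finitely generated `ℤ[C]`-module, torsion free as an abelian group, of
finite rank, with integral characteristic polynomial, and with `M^C = 0`.  Let
`n = χ_M(1)`.  Then `nⁱ·M ⊆ M·Iⁱ` for every `i ≥ 1`, where `I` is the augmentation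
ideal (generated by `t - 1`), so that `M·Iⁱ` is the range of `(t-1)ⁱ`. -/
theorem stmt_4 (M : Type) [AddCommGroup M] (e : M ≃ₗ[ℤ] M)
    [NoZeroSMulDivisors ℤ M] [Module.Finite ℚ (ℚ ⊗[ℤ] M)]
    (hfg : IsCFG M e)
    (hchi : ∃ p : Polynomial ℤ, p.map (Int.castRingHom ℚ) = LinearMap.charpoly (aM M e))
    (hinv : ∀ m : M, e m = m → m = 0)
    (n : ℤ) (hn : (n : ℚ) = (LinearMap.charpoly (aM M e)).eval 1) :
    ∀ i : ℕ, 1 ≤ i → ∀ m : M, n ^ i • m ∈ LinearMap.range (tsub M e ^ i) := by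
  obtain ⟨p, hp⟩ := hchi
  set f : Module.End ℤ M := e.toLinearMap with hf
  have hinj : Function.Injective (fun m : M => (1 : ℚ) ⊗ₜ[ℤ] m) := by
    haveI : Module.IsTorsionFree ℤ M := inferInstance
    haveI : Module.Flat ℤ M := inferInstance
    have h1 : Function.Injective (Algebra.linearMap ℤ ℚ) := by
      intro a b h
      simpa using h
    have h2 := Module.Flat.rTensor_preserves_injective_linearMap (M := M) _ h1
    have h3 := h2.comp (TensorProduct.lid ℤ M).symm.injective
    intro a b hab
    apply h3
    simpa using hab
  have hkill : aeval f p = 0 := by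
    have hCH := LinearMap.aeval_self_charpoly (aM M e)
    rw [← hp] at hCH
    have key : ∀ q : ℤ[X], ∀ m : M, aeval (aM M e) (q.map (Int.castRingHom ℚ)) ((1 : ℚ) ⊗ₜ[ℤ] m)
        = (1 : ℚ) ⊗ₜ[ℤ] (aeval f q m) := by
      intro q
      induction q using Polynomial.induction_on' with
      | add a b ha hb => intro m; simp [ha, hb, TensorProduct.tmul_add]
      | monomial k a =>
        have hk : ∀ m : M, (aM M e ^ k) ((1 : ℚ) ⊗ₜ[ℤ] m) = (1 : ℚ) ⊗ₜ[ℤ] ((f ^ k) m) := by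
          induction k with
          | zero => intro m; simp
          | succ k ih =>
            intro m
            rw [pow_succ, pow_succ, Module.End.mul_apply, Module.End.mul_apply, ← ih]
            simp [aM, hf]
        intro m
        simp only [Polynomial.map_monomial, aeval_monomial, Module.End.mul_apply, hk]
        simp [Module.algebraMap_end_apply]
    ext m
    apply hinj
    have := key p m
    rw [hCH] at this
    simpa using this.symm
  have hpn : p.eval 1 = n := by
    rw [← hp] at hn
    have : ((p.eval 1 : ℤ) : ℚ) = n := by
      rw [hn, Polynomial.eval_map, Polynomial.eval₂_at_one]
      simp
    exact_mod_cast this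
  obtain ⟨q, hq⟩ : X - C 1 ∣ p - C n := by
    rw [← hpn]; exact Polynomial.X_sub_C_dvd_sub_C_eval
  have hpow : ∀ i : ℕ, ∀ m : M, n ^ i • m = (tsub M e ^ i) (aeval f ((-q) ^ i) m) := by
    intro i m
    have ht : tsub M e = aeval f (X - C 1 : ℤ[X]) := by
      simp [tsub, hf, Module.End.one_eq_id]
    have hq' : aeval f (C n : ℤ[X]) = aeval f ((X - C 1) * (-q)) := by
      have : (C n : ℤ[X]) = p + (X - C 1) * (-q) := by linear_combination -hq
      rw [this, map_add, hkill, zero_add]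
    rw [ht, ← map_pow, ← Module.End.mul_apply, ← map_mul, ← mul_pow, map_pow, ← hq', ← map_pow,
      ← C_pow, aeval_C, Module.algebraMap_end_apply]
  intro i _ m
  exact ⟨_, (hpow i m).symm⟩
end
end

section
/- Let M be a finitely generated ℤ[C]-module that is torsion-free as an abelian group, has finite rank, and has integral characteristic polynomial χ_M. If μ_M(1) ∈ {−1, 1}, then M is perfect, i.e., M·I = M. -/
open Polynomial TensorProduct

noncomputable section

theorem aM_aeval (M : Type) [AddCommGroup M] (e : M ≃ₗ[ℤ] M) (q : Polynomial ℤ) (m : M) :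
    (aeval (aM M e) (q.map (algebraMap ℤ ℚ))) ((1 : ℚ) ⊗ₜ[ℤ] m)
      = (1 : ℚ) ⊗ₜ[ℤ] (aeval e.toLinearMap q m) := by
  have hpow : ∀ (n : ℕ) (m : M), ((aM M e) ^ n) ((1 : ℚ) ⊗ₜ[ℤ] m)
      = (1 : ℚ) ⊗ₜ[ℤ] ((e.toLinearMap ^ n) m) := by
    intro n
    induction n with
    | zero => intro m; simp
    | succ k ih =>
      intro m
      rw [pow_succ, pow_succ, Module.End.mul_apply, Module.End.mul_apply, ← ih]
      simp [aM]
  induction q using Polynomial.induction_on' with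
  | add p q hp hq =>
    rw [Polynomial.map_add, map_add, map_add, LinearMap.add_apply, LinearMap.add_apply, hp, hq,
      TensorProduct.tmul_add]
  | monomial n a =>
    rw [Polynomial.map_monomial, aeval_monomial, aeval_monomial, Module.End.mul_apply,
      Module.End.mul_apply, hpow, Module.algebraMap_end_apply, Module.algebraMap_end_apply,
      TensorProduct.tmul_smul, algebraMap_smul]

theorem one_tmul_injective (M : Type) [AddCommGroup M] [NoZeroSMulDivisors ℤ M] (m : M)
    (h : (1 : ℚ) ⊗ₜ[ℤ] m = 0) : m = 0 := by
  have : Module.IsTorsionFree ℤ M := inferInstance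
  have : Module.Flat ℤ M := inferInstance
  have hinj := Module.Flat.rTensor_preserves_injective_linearMap (M := M)
    (Algebra.linearMap ℤ ℚ) (by intro a b hab; simpa using hab)
  have h1 : (LinearMap.rTensor M (Algebra.linearMap ℤ ℚ)) ((1 : ℤ) ⊗ₜ[ℤ] m) = 0 := by
    simpa using h
  have h2 := hinj (h1.trans (map_zero _).symm)
  simpa using congrArg (TensorProduct.lid ℤ M) h2

/-- Let `M` be a finitely generated `ℤ[C]`-module, torsion free as an abelian group, of
finite rank, and with integral characteristic polynomial.  If `μ_M(1) ∈ {-1, 1}`, then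
`M` is perfect, i.e. `M·I = M` where `I` is the augmentation ideal. -/
theorem stmt_5 (M : Type) [AddCommGroup M] (e : M ≃ₗ[ℤ] M)
    [NoZeroSMulDivisors ℤ M] [Module.Finite ℚ (ℚ ⊗[ℤ] M)]
    (hfg : IsCFG M e)
    (hchi : ∃ p : Polynomial ℤ, p.map (Int.castRingHom ℚ) = LinearMap.charpoly (aM M e))
    (hmu : (minpoly ℚ (aM M e)).eval 1 = 1 ∨ (minpoly ℚ (aM M e)).eval 1 = -1) :
    LinearMap.range (tsub M e) = ⊤ := by
  obtain ⟨p, hp⟩ := hchi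
  have hpm : p.Monic := by
    apply Polynomial.monic_of_injective (f := Int.castRingHom ℚ) Int.cast_injective
    rw [hp]
    exact LinearMap.charpoly_monic _
  have hdvd : minpoly ℚ (aM M e) ∣ p.map (algebraMap ℤ ℚ) := by
    have h0 : p.map (algebraMap ℤ ℚ) = LinearMap.charpoly (aM M e) := hp
    rw [h0]
    exact LinearMap.minpoly_dvd_charpoly _
  obtain ⟨g, hg⟩ := IsIntegrallyClosed.eq_map_mul_C_of_dvd ℚ hpm hdvd
  have hmon : (minpoly ℚ (aM M e)).Monic := minpoly.monic (Algebra.IsIntegral.isIntegral _)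
  rw [hmon.leadingCoeff, C_1, mul_one] at hg
  have hzero : ∀ m : M, aeval e.toLinearMap g m = 0 := by
    intro m
    apply one_tmul_injective
    rw [← aM_aeval, hg, minpoly.aeval, LinearMap.zero_apply]
  have hev : g.eval 1 = 1 ∨ g.eval 1 = -1 := by
    have h1 : ((g.eval 1 : ℤ) : ℚ) = (minpoly ℚ (aM M e)).eval 1 := by
      rw [← hg, Polynomial.eval_one_map]
      simp
    rw [← h1] at hmu
    exact_mod_cast hmu
  have hdiv : (X - C 1) * (g /ₘ (X - C 1)) + C (g.eval 1) = g := by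
    have := Polynomial.modByMonic_add_div g (X - C (1 : ℤ))
    rw [Polynomial.modByMonic_X_sub_C_eq_C_eval] at this
    rw [add_comm]; exact this
  have key : ∀ m : M, tsub M e (aeval e.toLinearMap (g /ₘ (X - C 1)) m) + g.eval 1 • m = 0 := by
    intro m
    have h := hzero m
    rw [← hdiv, map_add, map_mul, map_sub, aeval_X, aeval_C, aeval_C, LinearMap.add_apply,
      Module.End.mul_apply, Module.algebraMap_end_apply, map_one] at h
    exact h
  rw [LinearMap.range_eq_top]
  intro m
  rcases hev with h | h
  · refine ⟨-(aeval e.toLinearMap (g /ₘ (X - C 1)) m), ?_⟩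
    have := key m
    rw [h, one_smul] at this
    rw [map_neg]
    exact neg_eq_of_add_eq_zero_right this
  · refine ⟨aeval e.toLinearMap (g /ₘ (X - C 1)) m, ?_⟩
    have := key m
    rw [h, neg_smul, one_smul] at this
    exact add_neg_eq_zero.mp this
end
end

section
/- Let M be a tame ℤ[C]-module, i.e., M is finitely generated over ℤ[C], its torsion subgroup is finite, M has finite rank, and χ_M has integer coefficients. Suppose μ_M = (x−1)^m · f for some m ≥ 0 and some integral polynomial f with f(1) ∈ {−1, 1}. Then M is prenilpotent: there exists n such that M·I^n = M·I^{n+1}. -/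
open Polynomial TensorProduct

noncomputable section

/-- Let `M` be a tame `ℤ[C]`-module (finitely generated over `ℤ[C]`, finite torsion
subgroup, finite rank, integral characteristic polynomial).  Suppose
`μ_M = (x-1)^m · f` for some `m ≥ 0` and an integral polynomial `f` with
`f(1) ∈ {-1, 1}`.  Then `M` is prenilpotent: `M·Iⁿ = M·Iⁿ⁺¹` for some `n`. -/
theorem stmt_6 (M : Type) [AddCommGroup M] (e : M ≃ₗ[ℤ] M)
    [Module.Finite ℚ (ℚ ⊗[ℤ] M)]
    (hfg : IsCFG M e)
    (htor : Finite (Submodule.torsion ℤ M))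
    (hchi : ∃ p : Polynomial ℤ, p.map (Int.castRingHom ℚ) = LinearMap.charpoly (aM M e))
    (mm : ℕ) (f : Polynomial ℤ)
    (hf : f.eval 1 = 1 ∨ f.eval 1 = -1)
    (hmu : minpoly ℚ (aM M e) = ((Polynomial.X - 1) ^ mm * f).map (Int.castRingHom ℚ)) :
    ∃ n : ℕ, LinearMap.range (tsub M e ^ n) = LinearMap.range (tsub M e ^ (n + 1)) := by
  set d := tsub M e with hd
  set T : Submodule ℤ M := Submodule.torsion ℤ M with hT
  have key : ∀ x : M, aeval e.toLinearMap ((X - 1) ^ mm * f) x ∈ T := by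
    intro x
    set P : Polynomial ℤ := (X - 1) ^ mm * f
    have h0 : aeval (aM M e) (P.map (Int.castRingHom ℚ)) = 0 := by
      rw [← hmu]; exact minpoly.aeval ℚ _
    have h2 : ∀ (Q : Polynomial ℤ) (y : M), aeval (aM M e) (Q.map (Int.castRingHom ℚ))
        ((1 : ℚ) ⊗ₜ[ℤ] y) = (1 : ℚ) ⊗ₜ[ℤ] (aeval e.toLinearMap Q y) := by
      intro Q
      induction Q using Polynomial.induction_on' with
      | add p q hp hq =>
        intro y
        simp only [Polynomial.map_add, map_add, LinearMap.add_apply, hp, hq,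
          TensorProduct.tmul_add]
      | monomial n a =>
        intro y
        have h3 : ∀ n : ℕ, ∀ y : M, (aM M e ^ n) ((1 : ℚ) ⊗ₜ[ℤ] y)
            = (1 : ℚ) ⊗ₜ[ℤ] ((e.toLinearMap ^ n) y) := by
          intro n
          induction n with
          | zero => intro y; simp
          | succ n ih =>
            intro y
            rw [pow_succ, pow_succ, Module.End.mul_apply, Module.End.mul_apply, ← ih]
            rfl
        rw [Polynomial.map_monomial, aeval_monomial, aeval_monomial, Module.End.mul_apply,
          Module.End.mul_apply, h3, Module.algebraMap_end_apply, Module.algebraMap_end_apply,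
          TensorProduct.tmul_smul]
        simp [Int.cast_smul_eq_zsmul]
    have h4 := h2 P x
    rw [h0, LinearMap.zero_apply] at h4
    have h5 := (IsLocalizedModule.eq_zero_iff (nonZeroDivisors ℤ)
      (TensorProduct.mk ℤ ℚ M 1)).1 h4.symm
    rw [hT, Submodule.mem_torsion_iff]
    exact h5
  have hed : e.toLinearMap = d + 1 := by
    rw [hd, tsub, Module.End.one_eq_id]; abel
  obtain ⟨g, hg⟩ : ∃ g : Polynomial ℤ, f = C (f.eval 1) + (X - 1) * g := by
    obtain ⟨g, hg⟩ := X_sub_C_dvd_sub_C_eval (a := (1 : ℤ)) (p := f)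
    refine ⟨g, ?_⟩
    rw [map_one] at hg
    rw [← hg]; ring
  have hdx : aeval e.toLinearMap (X - 1 : Polynomial ℤ) = d := by
    rw [map_sub, aeval_X, map_one, hed]; abel
  have key2 : ∀ x : M, ∃ z : M, (d ^ mm) x - (d ^ (mm + 1)) z ∈ T := by
    intro x
    have h := key x
    have h6 : aeval e.toLinearMap ((X - 1) ^ mm * f) x = (f.eval 1) • (d ^ mm) x
        + (d ^ (mm + 1)) (aeval e.toLinearMap g x) := by
      have : (X - 1) ^ mm * f = C (f.eval 1) * (X - 1) ^ mm + (X - 1) ^ (mm + 1) * g := by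
        conv_lhs => rw [hg]
        ring
      rw [this, map_add, map_mul, map_mul, map_pow, map_pow, hdx, aeval_C]
      rfl
    rw [h6] at h
    rcases hf with hf | hf
    · refine ⟨-aeval e.toLinearMap g x, ?_⟩
      rw [hf, one_smul] at h
      rwa [map_neg, sub_neg_eq_add]
    · refine ⟨aeval e.toLinearMap g x, ?_⟩
      rw [hf, neg_one_smul] at h
      have := T.neg_mem h
      rwa [neg_add, neg_neg, ← sub_eq_add_neg] at this
  have hTd : ∀ x ∈ T, d x ∈ T := by
    intro x hx
    rw [hT, Submodule.mem_torsion_iff] at hx ⊢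
    obtain ⟨a, ha⟩ := hx
    refine ⟨a, ?_⟩
    have : (a : ℤ) • x = 0 := ha
    change (a : ℤ) • d x = 0
    rw [← map_smul, this, map_zero]
  have key3 : ∀ k : ℕ, ∀ x : M, ∃ z : M, (d ^ (k + mm)) x - (d ^ (k + mm + 1)) z ∈ T := by
    intro k
    induction k with
    | zero => intro x; simpa using key2 x
    | succ k ih =>
      intro x
      obtain ⟨z, hz⟩ := ih x
      refine ⟨z, ?_⟩
      have := hTd _ hz
      rw [map_sub, ← Module.End.mul_apply, ← Module.End.mul_apply, ← pow_succ', ← pow_succ'] at this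
      rwa [add_right_comm k 1 mm]
  have hanti : ∀ k, LinearMap.range (d ^ (k + 1)) ≤ LinearMap.range (d ^ k) := by
    rintro k _ ⟨x, rfl⟩
    exact ⟨d x, by rw [pow_succ, Module.End.mul_apply]⟩
  have : Finite T := htor
  let F : ℕ →o (Submodule ℤ T)ᵒᵈ :=
    ⟨fun k => OrderDual.toDual ((LinearMap.range (d ^ k)).comap T.subtype),
      monotone_nat_of_le_succ fun k => Submodule.comap_mono (hanti k)⟩
  obtain ⟨N, hN⟩ := WellFoundedGT.monotone_chain_condition F
  refine ⟨N + mm, le_antisymm ?_ (hanti _)⟩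
  rintro _ ⟨x, rfl⟩
  obtain ⟨z, hz⟩ := key3 N x
  have e1 : (LinearMap.range (d ^ (N + mm))).comap T.subtype
      = (LinearMap.range (d ^ (N + mm + 1))).comap T.subtype :=
    (hN (N + mm) (by omega)).symm.trans (hN (N + mm + 1) (by omega))
  have h7 : (⟨_, hz⟩ : T) ∈ (LinearMap.range (d ^ (N + mm))).comap T.subtype :=
    Submodule.sub_mem (LinearMap.range (d ^ (N + mm))) (LinearMap.mem_range_self _ x)
      (hanti _ (LinearMap.mem_range_self _ z))
  rw [e1] at h7
  have h8 : (d ^ (N + mm)) x - (d ^ (N + mm + 1)) z ∈ LinearMap.range (d ^ (N + mm + 1)) := h7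
  have := Submodule.add_mem _ h8 (LinearMap.mem_range_self _ z)
  rwa [sub_add_cancel] at this
end
end

section
/- Let M and M' be torsion-free abelian groups of finite rank, and let a : M → M and a' : M' → M' be automorphisms such that the induced ℚ-linear automorphisms of M ⊗ ℚ and M' ⊗ ℚ have characteristic polynomials with integer coefficients. Assume that no complex eigenvalue λ of a ⊗ ℚ and eigenvalue λ' of a' ⊗ ℚ satisfy λλ' = 1. Then the cokernel of the endomorphism (a ⊗ a') − 1 of M ⊗_ℤ M' is finite. -/
open Polynomial TensorProduct

lemma aux_inj (M : Type) [AddCommGroup M] [NoZeroSMulDivisors ℤ M] :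
    Function.Injective (TensorProduct.mk ℤ ℚ M 1) := by
  have : Module.IsTorsionFree ℤ M := inferInstance
  have h := Module.Flat.rTensor_preserves_injective_linearMap (M := M)
    (Algebra.linearMap ℤ ℚ) (by intro x y h; simpa using h)
  have e : (TensorProduct.mk ℤ ℚ M 1 : M → ℚ ⊗[ℤ] M) =
      (LinearMap.rTensor M (Algebra.linearMap ℤ ℚ)) ∘ (TensorProduct.lid ℤ M).symm := by
    ext m; simp
  rw [e]
  exact h.comp (LinearEquiv.injective _)

lemma aux_aeval (M : Type) [AddCommGroup M] [NoZeroSMulDivisors ℤ M]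
    [Module.Finite ℚ (ℚ ⊗[ℤ] M)] (a : M →ₗ[ℤ] M) (p : ℤ[X])
    (hp : p.map (Int.castRingHom ℚ) = LinearMap.charpoly (LinearMap.baseChange ℚ a)) :
    aeval a p = 0 := by
  have key : ∀ (q : ℤ[X]) (m : M), aeval (LinearMap.baseChange ℚ a)
      (q.map (Int.castRingHom ℚ)) (1 ⊗ₜ m) = 1 ⊗ₜ (aeval a q m) := by
    intro q m
    have hpow : ∀ (n : ℕ), ((LinearMap.baseChange ℚ a) ^ n) (1 ⊗ₜ m) = 1 ⊗ₜ[ℤ] ((a ^ n) m) := by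
      intro n
      induction n with
      | zero => simp
      | succ k ih => rw [pow_succ', pow_succ', Module.End.mul_apply, ih]; simp
    induction q using Polynomial.induction_on' with
    | add p q hp hq => simp [hp, hq, TensorProduct.tmul_add]
    | monomial n c =>
      rw [← C_mul_X_pow_eq_monomial]
      simp [hpow]
  ext m
  apply aux_inj M
  have := key p m
  rw [hp, LinearMap.aeval_self_charpoly] at this
  simpa using this.symm

lemma aux_card (M : Type) [AddCommGroup M] [NoZeroSMulDivisors ℤ M]
    [Module.Finite ℚ (ℚ ⊗[ℤ] M)] (n : ℤ) (hn : n ≠ 0) :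
    ∃ S : Submodule ℤ M, S.FG ∧ ∀ m : M, ∃ s ∈ S, ∃ m' : M, m = s + n • m' := by
  classical
  have : Module.IsTorsionFree ℤ M := inferInstance
  let K : Submodule ℤ M := LinearMap.range (LinearMap.lsmul ℤ M n)
  have hfin : Finite (M ⧸ K) := by
    by_contra hinf
    rw [not_finite_iff_infinite] at hinf
    set r := Module.finrank ℚ (ℚ ⊗[ℤ] M)
    obtain ⟨T, hT⟩ := Infinite.exists_subset_card_eq (M ⧸ K) (n.natAbs ^ r + 1)
    let H : Submodule ℤ M := Submodule.span ℤ (Set.image Quotient.out (T : Set (M ⧸ K)))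
    have hH : H.FG := Submodule.fg_span (T.finite_toSet.image _)
    have : Module.Finite ℤ H := Module.Finite.iff_fg.mpr hH
    let b := Module.finBasis ℤ H
    have hli : LinearIndependent ℤ (fun i => (b i : M)) :=
      b.linearIndependent.map' H.subtype (by simp)
    have hli2 : LinearIndependent ℤ (fun i => TensorProduct.mk ℤ ℚ M 1 (b i : M)) :=
      hli.map' (TensorProduct.mk ℤ ℚ M 1) (LinearMap.ker_eq_bot.mpr (aux_inj M))
    have hli3 := hli2.localization ℚ (nonZeroDivisors ℤ)
    have hk : Module.finrank ℤ H ≤ r := by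
      simpa using hli3.fintype_card_le_finrank
    let g : (Fin (Module.finrank ℤ H) → Fin n.natAbs) → M ⧸ K :=
      fun c => K.mkQ (∑ i, ((c i : ℕ) : ℤ) • (b i : M))
    have hsub : T ⊆ Finset.univ.image g := by
      intro t ht
      have hout : (Quotient.out t : M) ∈ H := Submodule.subset_span ⟨t, ht, rfl⟩
      have hpos : 0 < n.natAbs := Int.natAbs_pos.mpr hn
      rw [Finset.mem_image]
      let x : H := ⟨Quotient.out t, hout⟩
      refine ⟨fun i => ⟨((b.repr x i) % n).toNat, ?_⟩, Finset.mem_univ _, ?_⟩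
      · have h1 := Int.emod_nonneg (b.repr x i) hn
        have h2 := Int.emod_lt_abs (b.repr x i) hn
        rw [Int.abs_eq_natAbs] at h2
        omega
      · have ht' : t = K.mkQ (Quotient.out t) := (Quotient.out_eq t).symm
        have hx : (Quotient.out t : M) = ∑ i, b.repr x i • (b i : M) := by
          have := congrArg H.subtype (b.sum_repr x)
          rw [map_sum] at this
          exact this.symm
        conv_rhs => rw [ht', hx]
        simp only [g]
        rw [← sub_eq_zero, ← map_sub, ← Finset.sum_sub_distrib, Submodule.mkQ_apply,
          Submodule.Quotient.mk_eq_zero]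
        refine Submodule.sum_mem _ fun i _ => ?_
        refine ⟨-((b.repr x i) / n) • (b i : M), ?_⟩
        have h1 := Int.emod_nonneg (b.repr x i) hn
        rw [Int.toNat_of_nonneg h1, ← sub_smul, LinearMap.lsmul_apply, smul_smul]
        congr 1
        have := Int.emod_add_mul_ediv (b.repr x i) n
        linarith
    have h1 := Finset.card_le_card hsub
    have h2 : (Finset.univ.image g).card ≤ n.natAbs ^ (Module.finrank ℤ H) := by
      refine Finset.card_image_le.trans ?_
      simp
    have h3 : n.natAbs ^ (Module.finrank ℤ H) ≤ n.natAbs ^ r :=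
      Nat.pow_le_pow_right (Int.natAbs_pos.mpr hn) hk
    omega
  refine ⟨Submodule.span ℤ (Set.range (Quotient.out : M ⧸ K → M)),
    Submodule.fg_span (Set.finite_range _), fun m => ?_⟩
  refine ⟨Quotient.out (K.mkQ m), Submodule.subset_span ⟨_, rfl⟩, ?_⟩
  have : K.mkQ (m - Quotient.out (K.mkQ m)) = 0 := by
    rw [map_sub, sub_eq_zero]
    exact (Quotient.out_eq (K.mkQ m)).symm
  rw [Submodule.mkQ_apply, Submodule.Quotient.mk_eq_zero] at this
  obtain ⟨m', hm'⟩ := this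
  refine ⟨m', ?_⟩
  have : n • m' = m - Quotient.out (K.mkQ m) := hm'
  rw [this]; abel

lemma aux_bezout (p q : ℤ[X]) (hq : q.Monic)
    (h : ∀ x y : ℂ, aeval x p = 0 → aeval y q = 0 → x * y ≠ 1) :
    ∃ (n : ℤ) (u w : ℤ[X]), n ≠ 0 ∧ u * p + w * q.reverse = C n := by
  have hinj : Function.Injective (Int.castRingHom ℚ) := Int.cast_injective
  have hcop : IsCoprime (p.map (Int.castRingHom ℚ)) (q.reverse.map (Int.castRingHom ℚ)) := by
    rw [Polynomial.isCoprime_iff_aeval_ne_zero_of_isAlgClosed (k := ℚ) (K := ℂ)]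
    intro x
    by_contra! hx
    obtain ⟨h1, h2⟩ := hx
    have e : ∀ s : ℤ[X], aeval x (s.map (Int.castRingHom ℚ)) = aeval x s :=
      fun s => Polynomial.aeval_map_algebraMap ℚ x s
    rw [e] at h1 h2
    have hx0 : x ≠ 0 := by
      rintro rfl
      rw [← Polynomial.coeff_zero_eq_aeval_zero', Polynomial.coeff_zero_reverse, hq] at h2
      simp at h2
    have : Invertible (x⁻¹) := invertibleOfNonzero (inv_ne_zero hx0)
    have h3 := (Polynomial.eval₂_reverse_eq_zero_iff (algebraMap ℤ ℂ) (x⁻¹) q).1 (by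
      rw [invOf_eq_inv, inv_inv]; exact h2)
    exact h x x⁻¹ h1 h3 (mul_inv_cancel₀ hx0)
  obtain ⟨u, w, huw⟩ := hcop
  obtain ⟨b, hb0, hb⟩ := IsLocalization.integerNormalization_spec (nonZeroDivisors ℤ) u
  obtain ⟨c, hc0, hc⟩ := IsLocalization.integerNormalization_spec (nonZeroDivisors ℤ) w
  set U := IsLocalization.integerNormalization (nonZeroDivisors ℤ) u
  set W := IsLocalization.integerNormalization (nonZeroDivisors ℤ) w
  refine ⟨b * c, C (c : ℤ) * U, C (b : ℤ) * W, mul_ne_zero (nonZeroDivisors.ne_zero hb0)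
    (nonZeroDivisors.ne_zero hc0), ?_⟩
  apply Polynomial.map_injective _ hinj
  change U.map (Int.castRingHom ℚ) = _ at hb
  change W.map (Int.castRingHom ℚ) = _ at hc
  rw [zsmul_eq_mul] at hb hc
  simp only [Polynomial.map_add, Polynomial.map_mul, hb, hc, Polynomial.map_C]
  simp only [map_mul, eq_intCast, map_intCast]
  linear_combination ((b : ℤ) : ℚ[X]) * ((c : ℤ) : ℚ[X]) * huw

lemma aux_reflect (N : Type) [AddCommGroup N] (B D : N →ₗ[ℤ] N) (hBD : Commute B D)
    (v : N) (n : ℕ) (q : ℤ[X]) (hq : q.natDegree ≤ n) :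
    (B ^ n) (aeval D q v) - aeval B (q.reflect n) v ∈ LinearMap.range (B * D - 1) := by
  refine Polynomial.induction_with_natDegree_le
    (motive := fun q => (B ^ n) (aeval D q v) - aeval B (q.reflect n) v ∈
      LinearMap.range (B * D - 1)) n ?_ ?_ ?_ q hq
  · simp
  · intro i r hr hi
    rw [Polynomial.reflect_C_mul_X_pow, Polynomial.revAt_le hi]
    obtain ⟨k, rfl⟩ := Nat.exists_eq_add_of_le hi
    have h1 : B ^ (i + k) * D ^ i - B ^ k = (B * D - 1) *
        ((∑ j ∈ Finset.range i, (B * D) ^ j) * B ^ k) := by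
      rw [← mul_assoc, mul_geom_sum, sub_mul, one_mul, hBD.mul_pow, pow_add, mul_assoc, mul_assoc,
        (hBD.pow_pow k i).eq]
    refine ⟨r • ((∑ j ∈ Finset.range i, (B * D) ^ j) * B ^ k) v, ?_⟩
    rw [map_smul, ← Module.End.mul_apply, ← h1]
    simp [smul_sub, Module.algebraMap_end_apply]
  · intro f g hfg hg ihf ihg
    have := add_mem ihf ihg
    convert this using 1
    simp only [map_add, LinearMap.add_apply, Polynomial.reflect_add]
    abel

/-- Let `M, M'` be torsion-free abelian groups of finite rank with automorphisms
`a, a'` whose induced `ℚ`-linear automorphisms of `M ⊗ ℚ` and `M' ⊗ ℚ` have integral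
characteristic polynomials.  If no complex eigenvalues `λ` of `a ⊗ ℚ` and `λ'` of
`a' ⊗ ℚ` satisfy `λ·λ' = 1`, then the cokernel of the endomorphism `(a ⊗ a') - 1` of
`M ⊗_ℤ M'` is finite. -/
theorem stmt_9 (M M' : Type) [AddCommGroup M] [AddCommGroup M']
    [NoZeroSMulDivisors ℤ M] [NoZeroSMulDivisors ℤ M']
    [Module.Finite ℚ (ℚ ⊗[ℤ] M)] [Module.Finite ℚ (ℚ ⊗[ℤ] M')]
    (a : M ≃ₗ[ℤ] M) (a' : M' ≃ₗ[ℤ] M')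
    (hchi : ∃ p : Polynomial ℤ, p.map (Int.castRingHom ℚ) =
      LinearMap.charpoly (LinearMap.baseChange ℚ a.toLinearMap))
    (hchi' : ∃ p : Polynomial ℤ, p.map (Int.castRingHom ℚ) =
      LinearMap.charpoly (LinearMap.baseChange ℚ a'.toLinearMap))
    (heig : ∀ lam lam' : ℂ,
      ((LinearMap.charpoly (LinearMap.baseChange ℚ a.toLinearMap)).map
        (algebraMap ℚ ℂ)).IsRoot lam →
      ((LinearMap.charpoly (LinearMap.baseChange ℚ a'.toLinearMap)).map
        (algebraMap ℚ ℂ)).IsRoot lam' →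
      lam * lam' ≠ 1) :
    Finite ((M ⊗[ℤ] M') ⧸
      LinearMap.range
        (TensorProduct.map a.toLinearMap a'.toLinearMap -
          LinearMap.id : (M ⊗[ℤ] M') →ₗ[ℤ] M ⊗[ℤ] M')) := by
  obtain ⟨p, hp⟩ := hchi
  obtain ⟨q, hq⟩ := hchi'
  have hpa := aux_aeval M a.toLinearMap p hp
  have hqa := aux_aeval M' a'.toLinearMap q hq
  have hqm : q.Monic := by
    apply Polynomial.monic_of_injective (f := Int.castRingHom ℚ) Int.cast_injective
    rw [hq]; exact LinearMap.charpoly_monic _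
  have hroot : ∀ (s : ℤ[X]) (x : ℂ), aeval x s = 0 →
      ((s.map (Int.castRingHom ℚ)).map (algebraMap ℚ ℂ)).IsRoot x := by
    intro s x hx
    rw [Polynomial.IsRoot, Polynomial.eval_map_algebraMap]
    exact (Polynomial.aeval_map_algebraMap ℚ x s).trans hx
  obtain ⟨n, u, w, hn, huw⟩ := aux_bezout p q hqm (fun x y hx hy =>
    heig x y (hp ▸ hroot p x hx) (hq ▸ hroot q y hy))
  let B : (M ⊗[ℤ] M') →ₗ[ℤ] M ⊗[ℤ] M' := LinearMap.rTensor M' a.toLinearMap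
  let D : (M ⊗[ℤ] M') →ₗ[ℤ] M ⊗[ℤ] M' := LinearMap.lTensor M a'.toLinearMap
  have hBDmul : TensorProduct.map a.toLinearMap a'.toLinearMap = B * D := by
    refine TensorProduct.ext' fun x y => ?_
    change _ = B (D (x ⊗ₜ y))
    rfl
  have hBD : Commute B D := by
    change B * D = D * B
    refine TensorProduct.ext' fun x y => ?_
    change B (D (x ⊗ₜ y)) = D (B (x ⊗ₜ y))
    rfl
  have hpB : aeval B p = 0 := by
    have := Polynomial.aeval_algHom_apply (Module.End.rTensorAlgHom ℤ M M') a.toLinearMap p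
    rw [hpa, map_zero] at this
    exact this
  have hqD : aeval D q = 0 := by
    have := Polynomial.aeval_algHom_apply (Module.End.lTensorAlgHom ℤ M' M) a'.toLinearMap q
    rw [hqa, map_zero] at this
    exact this
  have hrange : (TensorProduct.map a.toLinearMap a'.toLinearMap -
          LinearMap.id : (M ⊗[ℤ] M') →ₗ[ℤ] M ⊗[ℤ] M') = B * D - 1 := by
    rw [hBDmul]; rfl
  rw [hrange]
  set K := LinearMap.range (B * D - 1) with hK
  have hcomm : ∀ s : ℤ[X], Commute (aeval B s) (B * D - 1) := by
    intro s
    have h1 : Commute B (B * D - 1) :=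
      ((Commute.refl B).mul_right hBD).sub_right (Commute.one_right B)
    induction s using Polynomial.induction_on' with
    | add f g hf hg => rw [map_add]; exact hf.add_left hg
    | monomial i r =>
      rw [Polynomial.aeval_monomial]
      exact (Algebra.commute_algebraMap_left r _).mul_left (h1.pow_left i)
  have hkill : ∀ v, n • v ∈ K := by
    intro v
    have h1 := aux_reflect _ B D hBD v q.natDegree q le_rfl
    rw [hqD] at h1
    simp only [LinearMap.zero_apply, map_zero, zero_sub] at h1
    have h2 : aeval B q.reverse v ∈ K := by
      have h5 := neg_mem h1
      rw [neg_neg] at h5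
      exact h5
    have h3 := congrArg (fun s => aeval B s v) huw
    simp only [map_add, map_mul, hpB, mul_zero, zero_add, Module.End.mul_apply] at h3
    have h4 : aeval B (C n) v = n • v := by simp [Module.algebraMap_end_apply]
    rw [h4] at h3
    rw [← h3]
    obtain ⟨x, hx⟩ := h2
    refine ⟨aeval B w x, ?_⟩
    rw [← hx, ← Module.End.mul_apply, ← Module.End.mul_apply, (hcomm w).eq]
  obtain ⟨S, hS, hS'⟩ := aux_card M n hn
  obtain ⟨S₂, hS₂, hS₂'⟩ := aux_card M' n hn
  have : Module.Finite ℤ S := Module.Finite.iff_fg.mpr hS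
  have : Module.Finite ℤ S₂ := Module.Finite.iff_fg.mpr hS₂
  let g : (S ⊗[ℤ] S₂) →ₗ[ℤ] ((M ⊗[ℤ] M') ⧸ K) :=
    K.mkQ ∘ₗ TensorProduct.map S.subtype S₂.subtype
  have hkillQ : ∀ z : (M ⊗[ℤ] M') ⧸ K, n • z = 0 := by
    intro z
    obtain ⟨v, rfl⟩ := K.mkQ_surjective z
    rw [← map_smul, Submodule.mkQ_apply, Submodule.Quotient.mk_eq_zero]
    exact hkill v
  have hg : Function.Surjective g := by
    rw [← LinearMap.range_eq_top, eq_top_iff]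
    rintro z -
    obtain ⟨v, rfl⟩ := K.mkQ_surjective z
    induction v using TensorProduct.induction_on with
    | zero => simp
    | add x y hx hy => rw [map_add]; exact add_mem hx hy
    | tmul x y =>
      obtain ⟨s, hs, x', rfl⟩ := hS' x
      obtain ⟨t, ht, y', rfl⟩ := hS₂' y
      refine ⟨(⟨s, hs⟩ : S) ⊗ₜ (⟨t, ht⟩ : S₂), ?_⟩
      have : (s + n • x') ⊗ₜ[ℤ] (t + n • y') =
          s ⊗ₜ[ℤ] t + n • (x' ⊗ₜ[ℤ] (t + n • y') + s ⊗ₜ[ℤ] y') := by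
        rw [TensorProduct.add_tmul, TensorProduct.tmul_add s, TensorProduct.tmul_smul,
          ← TensorProduct.smul_tmul', smul_add]
        abel
      rw [this, map_add, map_smul, hkillQ, add_zero]
      rfl
  have : Module.Finite ℤ (S ⊗[ℤ] S₂) := Module.Finite.tensorProduct ℤ S S₂
  have : Module.Finite ℤ ((M ⊗[ℤ] M') ⧸ K) := Module.Finite.of_surjective g hg
  apply Module.finite_of_fg_torsion
  intro z
  exact ⟨⟨n, mem_nonZeroDivisors_of_ne_zero hn⟩, hkillQ z⟩
end

section
/- Let G, E_1, E_2, H be groups, let π : E_2 → G be a homomorphism whose kernel is contained in the center of E_2, and let θ, θ' : E_1 → E_2 be homomorphisms with π ∘ θ = π ∘ θ'. Let f : H → E_1 be a homomorphism such that θ ∘ f = θ' ∘ f, and assume f is perfect in the sense that the image of f together with the commutator subgroup [E_1, E_1] generates E_1. Then θ = θ'. -/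
open scoped commutatorElement

theorem comm_left_central {E : Type} [Group E] (a c b : E)
    (hz : a * c⁻¹ ∈ Subgroup.center E) : ⁅a, b⁆ = ⁅c, b⁆ := by
  have h1 := Subgroup.mem_center_iff.mp hz (c * b * c⁻¹)
  have h2 : a * b * a⁻¹ = c * b * c⁻¹ := by
    calc a * b * a⁻¹ = (a * c⁻¹) * (c * b * c⁻¹) * (a * c⁻¹)⁻¹ := by group
      _ = c * b * c⁻¹ := by rw [← h1]; group
  rw [commutatorElement_def, commutatorElement_def, h2]

/-- Let `π : E₂ → G` have central kernel, `θ, θ' : E₁ → E₂` with `π ∘ θ = π ∘ θ'`, and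
`f : H → E₁` with `θ ∘ f = θ' ∘ f`. If `f` is perfect (`Im(f)·[E₁,E₁] = E₁`), then
`θ = θ'`. -/
theorem stmt_13 {G E₁ E₂ H : Type} [Group G] [Group E₁] [Group E₂] [Group H]
    (π : E₂ →* G) (hπ : π.ker ≤ Subgroup.center E₂)
    (θ θ' : E₁ →* E₂) (h : π.comp θ = π.comp θ')
    (f : H →* E₁) (hf : θ.comp f = θ'.comp f)
    (hperf : f.range ⊔ commutator E₁ = ⊤) :
    θ = θ' := by
  have hz : ∀ x, θ x * (θ' x)⁻¹ ∈ Subgroup.center E₂ := by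
    intro x
    apply hπ
    have hx : π (θ x) = π (θ' x) := DFunLike.congr_fun h x
    rw [MonoidHom.mem_ker, map_mul, map_inv, hx, mul_inv_cancel]
  have key : f.range ⊔ commutator E₁ ≤ θ.eqLocus θ' := by
    apply sup_le
    · rintro _ ⟨y, rfl⟩
      exact DFunLike.congr_fun hf y
    · rw [commutator_def, Subgroup.commutator_le]
      intro x _ y _
      change θ ⁅x, y⁆ = θ' ⁅x, y⁆
      rw [map_commutatorElement, map_commutatorElement, comm_left_central _ _ _ (hz x),
        ← commutatorElement_inv, comm_left_central _ _ _ (hz y), commutatorElement_inv]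
  ext x
  exact key (hperf ▸ Subgroup.mem_top x)
end

section
/- The abelian group ℤ_2 ⊗_ℤ ℤ_2 (tensor square over ℤ of the 2-adic integers) is generated by the elements x ⊗ x for x ∈ ℤ_2 together with the elements x ⊗ y − y ⊗ x for x, y ∈ ℤ_2. -/
open TensorProduct

lemma padic_two_split (x : ℤ_[2]) : ∃ (n : ℤ) (y : ℤ_[2]), x = n • (1 : ℤ_[2]) + (2 : ℤ) • y := by
  have h := PadicInt.appr_spec 1 x
  rw [Ideal.mem_span_singleton] at h
  obtain ⟨y, hy⟩ := h
  refine ⟨x.appr 1, y, ?_⟩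
  simp only [zsmul_eq_mul]
  push_cast at hy ⊢
  linear_combination hy

/-- The abelian group `ℤ₂ ⊗_ℤ ℤ₂` (tensor square over `ℤ` of the `2`-adic integers) is
generated by the elements `x ⊗ x` together with the elements `x ⊗ y - y ⊗ x`. -/
theorem stmt_16 :
    AddSubgroup.closure
      ({z : ℤ_[2] ⊗[ℤ] ℤ_[2] | ∃ x : ℤ_[2], z = x ⊗ₜ[ℤ] x} ∪
        {z : ℤ_[2] ⊗[ℤ] ℤ_[2] | ∃ x y : ℤ_[2], z = x ⊗ₜ[ℤ] y - y ⊗ₜ[ℤ] x}) = ⊤ := by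
  set H := AddSubgroup.closure
      ({z : ℤ_[2] ⊗[ℤ] ℤ_[2] | ∃ x : ℤ_[2], z = x ⊗ₜ[ℤ] x} ∪
        {z : ℤ_[2] ⊗[ℤ] ℤ_[2] | ∃ x y : ℤ_[2], z = x ⊗ₜ[ℤ] y - y ⊗ₜ[ℤ] x}) with hH
  have h1 : ∀ x : ℤ_[2], x ⊗ₜ[ℤ] x ∈ H := fun x =>
    AddSubgroup.subset_closure (Or.inl ⟨x, rfl⟩)
  have h2 : ∀ x y : ℤ_[2], x ⊗ₜ[ℤ] y - y ⊗ₜ[ℤ] x ∈ H := fun x y =>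
    AddSubgroup.subset_closure (Or.inr ⟨x, y, rfl⟩)
  have h3 : ∀ x y : ℤ_[2], (2 : ℤ) • (x ⊗ₜ[ℤ] y) ∈ H := by
    intro x y
    have := H.add_mem (H.sub_mem (H.sub_mem (h1 (x + y)) (h1 x)) (h1 y)) (h2 x y)
    convert this using 1
    simp only [add_tmul, tmul_add]
    abel
  rw [eq_top_iff]
  intro t _
  induction t using TensorProduct.induction_on with
  | zero => exact H.zero_mem
  | add a b ha hb => exact H.add_mem (ha trivial) (hb trivial)
  | tmul x y =>
    obtain ⟨n, x', hx⟩ := padic_two_split x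
    obtain ⟨m, y', hy⟩ := padic_two_split y
    have key : x ⊗ₜ[ℤ] y = (n * m) • ((1 : ℤ_[2]) ⊗ₜ[ℤ] (1 : ℤ_[2]))
        + n • ((2 : ℤ) • ((1 : ℤ_[2]) ⊗ₜ[ℤ] y')) + (2 : ℤ) • (x' ⊗ₜ[ℤ] y) := by
      have e1 : (1 : ℤ_[2]) ⊗ₜ[ℤ] y = m • ((1 : ℤ_[2]) ⊗ₜ[ℤ] (1 : ℤ_[2]))
          + (2 : ℤ) • ((1 : ℤ_[2]) ⊗ₜ[ℤ] y') := by
        rw [hy, tmul_add, tmul_smul, tmul_smul]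
      have e2 : x ⊗ₜ[ℤ] y = n • ((1 : ℤ_[2]) ⊗ₜ[ℤ] y) + (2 : ℤ) • (x' ⊗ₜ[ℤ] y) := by
        rw [hx, add_tmul, ← smul_tmul', ← smul_tmul']
      rw [e2, e1, smul_add, mul_smul]
    rw [key]
    exact H.add_mem (H.add_mem (H.zsmul_mem (h1 1) _) (H.zsmul_mem (h3 _ _) _)) (h3 _ _)
end

section
/- Let M̂ = ℤ_2² (the free module of rank 2 over the 2-adic integers) with the automorphism c given by the matrix [[−1, 1], [0, −1]], i.e., c(e_1) = −e_1, c(e_2) = e_1 − e_2. Let Λ²M̂ denote the exterior square of M̂ over ℤ, with the induced automorphism Λ²c. Then the cokernel of the natural map from the invariants (Λ²M̂)^C = ker(Λ²c − 1) to the coinvariants (Λ²M̂)_C = coker(Λ²c − 1) (the composite of the inclusion of the kernel with the projection onto the cokernel) is isomorphic to Λ²ℤ_2, the exterior square over ℤ of the 2-adic integers. -/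
noncomputable section

/-- The morphism of exterior algebras induced by a `ℤ`-linear map carries the `n`-th
exterior power into the `n`-th exterior power. -/
theorem exmap_mem {M N : Type} [AddCommGroup M] [AddCommGroup N] (g : M →ₗ[ℤ] N) (n : ℕ) :
    ∀ x ∈ ⋀[ℤ]^n M, (ExteriorAlgebra.map g).toLinearMap x ∈ ⋀[ℤ]^n N := by
  intro x hx
  have h1 := Submodule.map_pow (ExteriorAlgebra.map g) n
    (M := LinearMap.range (ExteriorAlgebra.ι ℤ (M := M)))
  have h2 : Submodule.map (ExteriorAlgebra.map g).toLinearMap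
      (LinearMap.range (ExteriorAlgebra.ι ℤ (M := M)))
      ≤ LinearMap.range (ExteriorAlgebra.ι ℤ (M := N)) := by
    rw [ExteriorAlgebra.ι_range_map_map]
    rintro y ⟨z, ⟨w, rfl⟩, rfl⟩
    exact ⟨g w, rfl⟩
  have h3 : Submodule.map (ExteriorAlgebra.map g).toLinearMap
      ((LinearMap.range (ExteriorAlgebra.ι ℤ (M := M))) ^ n)
      ≤ (LinearMap.range (ExteriorAlgebra.ι ℤ (M := N))) ^ n := by
    rw [h1]
    exact pow_le_pow_left' h2 n
  exact h3 ⟨x, hx, rfl⟩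

/-- The automorphism `c` of `M̂ = ℤ₂²` given by the matrix `[[-1, 1], [0, -1]]`
(so `c e₁ = -e₁`, `c e₂ = e₁ - e₂`), as a `ℤ`-linear map. -/
def cTwo : (Fin 2 → ℤ_[2]) →ₗ[ℤ] Fin 2 → ℤ_[2] :=
  (Matrix.toLin' !![(-1 : ℤ_[2]), 1; 0, -1]).toAddMonoidHom.toIntLinearMap

/-- The induced automorphism `Λ²c` of the exterior square `Λ²M̂` over `ℤ`. -/
def lambda2c : (⋀[ℤ]^2 (Fin 2 → ℤ_[2])) →ₗ[ℤ] ⋀[ℤ]^2 (Fin 2 → ℤ_[2]) :=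
  (ExteriorAlgebra.map cTwo).toLinearMap.restrict
    (p := ⋀[ℤ]^2 (Fin 2 → ℤ_[2])) (q := ⋀[ℤ]^2 (Fin 2 → ℤ_[2])) (exmap_mem cTwo 2)

/-- The endomorphism `Λ²c - 1` of `Λ²M̂`; the invariants `(Λ²M̂)^C` are its kernel and
the coinvariants `(Λ²M̂)_C` are its cokernel. -/
def lambda2d : (⋀[ℤ]^2 (Fin 2 → ℤ_[2])) →ₗ[ℤ] ⋀[ℤ]^2 (Fin 2 → ℤ_[2]) :=
  lambda2c - LinearMap.id

/-- The natural map `(Λ²M̂)^C → (Λ²M̂)_C` from the invariants to the coinvariants,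
the composite of the inclusion of the kernel of `Λ²c - 1` with the projection onto its
cokernel. -/
def invToCoinv : LinearMap.ker lambda2d →ₗ[ℤ]
    (⋀[ℤ]^2 (Fin 2 → ℤ_[2]) : Submodule ℤ _) ⧸ LinearMap.range lambda2d :=
  (LinearMap.range lambda2d).mkQ.domRestrict (LinearMap.ker lambda2d)


def wdg {M : Type} [AddCommGroup M] (x y : M) : ⋀[ℤ]^2 M := exteriorPower.ιMulti ℤ 2 ![x, y]

section wdg
variable {M N : Type} [AddCommGroup M] [AddCommGroup N]

theorem wdg_self (x : M) : wdg x x = 0 :=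
  (exteriorPower.ιMulti ℤ 2).map_eq_zero_of_eq ![x, x] (i := 0) (j := 1) rfl (by decide)

theorem wdg_add_left (x x' y : M) : wdg (x + x') y = wdg x y + wdg x' y := by
  have h := (exteriorPower.ιMulti ℤ 2 (M := M)).map_update_add ![x, y] 0 x x'
  have e : ∀ z : M, Function.update ![x, y] 0 z = ![z, y] := by
    intro z; ext i; fin_cases i <;> simp
  simp only [e] at h
  exact h

theorem wdg_add_right (x y y' : M) : wdg x (y + y') = wdg x y + wdg x y' := by
  have h := (exteriorPower.ιMulti ℤ 2 (M := M)).map_update_add ![x, y] 1 y y'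
  have e : ∀ z : M, Function.update ![x, y] 1 z = ![x, z] := by
    intro z; ext i; fin_cases i <;> simp
  simp only [e] at h
  exact h

def wdgHom (x : M) : M →+ ⋀[ℤ]^2 M := AddMonoidHom.mk' (wdg x) (wdg_add_right x)
def wdgHom' (y : M) : M →+ ⋀[ℤ]^2 M :=
  AddMonoidHom.mk' (fun x => wdg x y) (fun x x' => wdg_add_left x x' y)

theorem wdg_zsmul_right (n : ℤ) (x y : M) : wdg x (n • y) = n • wdg x y :=
  map_zsmul (wdgHom x) n y
theorem wdg_zsmul_left (n : ℤ) (x y : M) : wdg (n • x) y = n • wdg x y :=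
  map_zsmul (wdgHom' y) n x
theorem wdg_neg_right (x y : M) : wdg x (-y) = - wdg x y := map_neg (wdgHom x) y
theorem wdg_neg_left (x y : M) : wdg (-x) y = - wdg x y := map_neg (wdgHom' y) x
theorem wdg_sub_right (x y y' : M) : wdg x (y - y') = wdg x y - wdg x y' :=
  map_sub (wdgHom x) y y'
theorem wdg_sub_left (x x' y : M) : wdg (x - x') y = wdg x y - wdg x' y :=
  map_sub (wdgHom' y) x x'
theorem wdg_zero_right (x : M) : wdg x 0 = 0 := map_zero (wdgHom x)
theorem wdg_zero_left (x : M) : wdg 0 x = 0 := map_zero (wdgHom' x)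

theorem wdg_swap (x y : M) : wdg x y = - wdg y x := by
  have h := wdg_self (x + y)
  rw [wdg_add_left, wdg_add_right, wdg_add_right, wdg_self, wdg_self, zero_add, add_zero] at h
  exact eq_neg_of_add_eq_zero_left h

theorem wdg_induction {S : Submodule ℤ (⋀[ℤ]^2 M)} (h : ∀ x y, wdg x y ∈ S) (z) : z ∈ S := by
  have h1 : Submodule.span ℤ (Set.range (exteriorPower.ιMulti ℤ 2 (M := M))) ≤ S := by
    rw [Submodule.span_le]
    rintro _ ⟨v, rfl⟩
    have e : v = ![v 0, v 1] := by ext i; fin_cases i <;> rfl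
    rw [e]; exact h _ _
  rw [exteriorPower.ιMulti_span] at h1
  exact h1 trivial

theorem wdg_ext {f g : (⋀[ℤ]^2 M) →ₗ[ℤ] N} (h : ∀ x y, f (wdg x y) = g (wdg x y)) : f = g := by
  ext z
  exact wdg_induction (S := LinearMap.eqLocus f g) h _

theorem map_wdg (f : M →ₗ[ℤ] N) (x y : M) :
    exteriorPower.map 2 f (wdg x y) = wdg (f x) (f y) := by
  unfold wdg
  rw [exteriorPower.map_apply_ιMulti]
  congr 1; ext i; fin_cases i <;> rfl

/-- linear map out of the exterior square from a biadditive alternating function -/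
def wlift (B : M → M → N) (ha : ∀ x x' y, B (x + x') y = B x y + B x' y)
    (hb : ∀ x y y', B x (y + y') = B x y + B x y') (hs : ∀ x, B x x = 0) :
    (⋀[ℤ]^2 M) →ₗ[ℤ] N :=
  exteriorPower.alternatingMapLinearEquiv
    { toFun := fun v => B (v 0) (v 1)
      map_update_add' := by
        intro _ v i x y
        fin_cases i <;> simp [Function.update, ha, hb]
      map_update_smul' := by
        intro _ v i n x
        have h1 : ∀ y, B (n • x) y = n • B x y := fun y =>
          map_zsmul (AddMonoidHom.mk' (fun x => B x y) (fun a b => ha a b y)) n x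
        have h2 : ∀ y, B y (n • x) = n • B y x := fun y =>
          map_zsmul (AddMonoidHom.mk' (fun x => B y x) (fun a b => hb y a b)) n x
        fin_cases i <;> simp [Function.update, h1, h2]
      map_eq_zero_of_eq' := by
        intro v i j hv hij
        have : v 0 = v 1 := by
          fin_cases i <;> fin_cases j <;> first | exact absurd rfl hij | exact hv | exact hv.symm
        simp [this, hs] }

theorem wlift_wdg (B : M → M → N) (ha hb hs) (x y : M) :
    wlift B ha hb hs (wdg x y) = B x y := by
  unfold wlift wdg
  rw [exteriorPower.alternatingMapLinearEquiv_apply_ιMulti]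
  rfl
end wdg

theorem exists_half (a : ℤ_[2]) : ∃ p : ℤ × ℤ_[2], a = p.1 • 1 + (2 : ℤ) • p.2 := by
  have h := PadicInt.appr_spec 1 a
  rw [Ideal.mem_span_singleton] at h
  obtain ⟨t, ht⟩ := h
  refine ⟨((a.appr 1 : ℕ), t), ?_⟩
  simp only [zsmul_eq_mul]
  push_cast at ht ⊢
  linear_combination ht

def hh (p q : ℤ × ℤ_[2]) : ⋀[ℤ]^2 ℤ_[2] :=
  wdg (p.1 • 1) q.2 + wdg p.2 (q.1 • 1) + (2 : ℤ) • wdg p.2 q.2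

theorem half_uniq {p p' : ℤ × ℤ_[2]}
    (h : p.1 • (1 : ℤ_[2]) + (2 : ℤ) • p.2 = p'.1 • 1 + (2 : ℤ) • p'.2) :
    ∃ k : ℤ, p' = (p.1 - 2 * k, p.2 + k • 1) := by
  have h2 : ‖((p.1 - p'.1 : ℤ) : ℤ_[2])‖ < 1 := by
    rw [PadicInt.norm_lt_one_iff_dvd]
    refine ⟨p'.2 - p.2, ?_⟩
    simp only [zsmul_eq_mul] at h
    push_cast at h ⊢
    linear_combination h
  rw [PadicInt.norm_intCast_lt_one_iff] at h2
  obtain ⟨k, hk⟩ := h2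
  push_cast at hk
  refine ⟨k, Prod.ext ?_ ?_⟩
  · simp only; linarith
  · simp only
    have h2 : (2 : ℤ_[2]) ≠ 0 := two_ne_zero
    apply mul_left_cancel₀ h2
    have hk' : ((p.1 : ℤ_[2]) - p'.1) = 2 * k := by exact_mod_cast congrArg (Int.cast : ℤ → ℤ_[2]) hk
    simp only [zsmul_eq_mul] at h ⊢
    push_cast at h ⊢
    linear_combination hk' - h

theorem hh_left {p p' q : ℤ × ℤ_[2]}
    (h : p.1 • (1 : ℤ_[2]) + (2 : ℤ) • p.2 = p'.1 • 1 + (2 : ℤ) • p'.2) : hh p q = hh p' q := by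
  obtain ⟨k, rfl⟩ := half_uniq h
  simp only [hh, wdg_add_left, wdg_zsmul_left, wdg_zsmul_right, wdg_self]
  module

theorem hh_swap (p q : ℤ × ℤ_[2]) : hh p q = - hh q p := by
  simp only [hh]
  rw [wdg_swap q.2, wdg_swap q.2, wdg_swap (q.1 • 1)]
  module

theorem hh_add (p p' q) : hh (p + p') q = hh p q + hh p' q := by
  simp only [hh, wdg_add_left, wdg_zsmul_left, wdg_zsmul_right, Prod.fst_add, Prod.snd_add]
  module

def dec (a : ℤ_[2]) : ℤ × ℤ_[2] := (exists_half a).choose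
theorem dec_spec (a : ℤ_[2]) : a = (dec a).1 • 1 + (2 : ℤ) • (dec a).2 := (exists_half a).choose_spec

theorem hh_dec_add (a b c) : hh (dec (a + b)) (dec c) = hh (dec a) (dec c) + hh (dec b) (dec c) := by
  rw [← hh_add]
  apply hh_left
  rw [← dec_spec]
  conv_lhs => rw [dec_spec a, dec_spec b]
  simp only [Prod.fst_add, Prod.snd_add]
  module

def halfMap : (⋀[ℤ]^2 ℤ_[2]) →ₗ[ℤ] ⋀[ℤ]^2 ℤ_[2] :=
  wlift (fun a b => hh (dec a) (dec b)) hh_dec_add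
    (fun x y y' => by
      rw [hh_swap, hh_dec_add, neg_add, ← hh_swap, ← hh_swap])
    (fun x => by
      simp only [hh, wdg_self]
      rw [wdg_swap]; simp)

theorem halfMap_two : (2 : ℤ) • halfMap = LinearMap.id := by
  apply wdg_ext
  intro a b
  simp only [LinearMap.smul_apply, LinearMap.id_apply, halfMap, wlift_wdg, hh]
  conv_rhs => rw [dec_spec a, dec_spec b]
  simp only [wdg_add_left, wdg_add_right, wdg_zsmul_left, wdg_zsmul_right, wdg_self]
  module

theorem two_tors (z : ⋀[ℤ]^2 ℤ_[2]) (h : (2 : ℤ) • z = 0) : z = 0 := by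
  have := LinearMap.congr_fun halfMap_two z
  rw [LinearMap.smul_apply, ← map_zsmul, h, map_zero] at this
  exact this.symm

abbrev MM := Fin 2 → ℤ_[2]
def pj (i : Fin 2) : MM →ₗ[ℤ] ℤ_[2] := LinearMap.proj i
def ej (i : Fin 2) : ℤ_[2] →ₗ[ℤ] MM := LinearMap.single ℤ (fun _ => ℤ_[2]) i

theorem mm_eq (x : MM) : x = ej 0 (x 0) + ej 1 (x 1) := by
  ext i; fin_cases i <;> simp [ej]

theorem c_apply (x : MM) : cTwo x = ![- x 0 + x 1, - x 1] := by
  ext i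
  fin_cases i <;> simp [cTwo, Matrix.mulVec, dotProduct, Fin.sum_univ_two]

theorem c_e0 (a) : cTwo (ej 0 a) = - ej 0 a := by
  rw [c_apply]; ext i; fin_cases i <;> simp [ej]
theorem c_e1 (a) : cTwo (ej 1 a) = ej 0 a - ej 1 a := by
  rw [c_apply]; ext i; fin_cases i <;> simp [ej]

theorem d_wdg (x y : MM) : lambda2d (wdg x y) = wdg (cTwo x) (cTwo y) - wdg x y := by
  have : lambda2c (wdg x y) = wdg (cTwo x) (cTwo y) := by
    apply Subtype.ext
    simp only [lambda2c, LinearMap.coe_restrict_apply, wdg, exteriorPower.ιMulti_apply_coe]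
    refine (ExteriorAlgebra.map_apply_ιMulti cTwo ![x, y]).trans ?_
    congr 1; ext i; fin_cases i <;> rfl
  rw [lambda2d, LinearMap.sub_apply, this]; rfl

def PP : (⋀[ℤ]^2 MM) →ₗ[ℤ] ⋀[ℤ]^2 ℤ_[2] := exteriorPower.map 2 (pj 1)
def GG : (⋀[ℤ]^2 MM) →ₗ[ℤ] ⋀[ℤ]^2 ℤ_[2] :=
  exteriorPower.map 2 (pj 0 + pj 1) - exteriorPower.map 2 (pj 0) - exteriorPower.map 2 (pj 1)

theorem GG_d : GG ∘ₗ lambda2d = (-2 : ℤ) • PP := by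
  apply wdg_ext
  intro x y
  simp only [LinearMap.comp_apply, d_wdg, map_sub, LinearMap.smul_apply, PP, GG,
    LinearMap.sub_apply, map_wdg, LinearMap.add_apply]
  simp only [pj, LinearMap.proj_apply, c_apply, Matrix.cons_val_zero, Matrix.cons_val_one]
  simp only [wdg_add_left, wdg_add_right, wdg_neg_left, wdg_neg_right]
  module

theorem PP_d : PP ∘ₗ lambda2d = 0 := by
  apply wdg_ext
  intro x y
  simp only [LinearMap.comp_apply, d_wdg, map_sub, PP, map_wdg]
  simp only [pj, LinearMap.proj_apply, c_apply, Matrix.cons_val_zero, Matrix.cons_val_one]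
  simp [wdg_neg_left, wdg_neg_right]

theorem PP_ker (z) (h : lambda2d z = 0) : PP z = 0 := by
  apply two_tors
  have := LinearMap.congr_fun GG_d z
  rw [LinearMap.comp_apply, h, map_zero, LinearMap.smul_apply] at this
  have h2 : (2 : ℤ) • PP z = - ((-2 : ℤ) • PP z) := by module
  rw [h2, ← this, neg_zero]

def SS : Submodule ℤ (⋀[ℤ]^2 MM) := LinearMap.ker lambda2d ⊔ LinearMap.range lambda2d

theorem ker_SS {z} (h : lambda2d z = 0) : z ∈ SS :=
  Submodule.mem_sup_left (LinearMap.mem_ker.2 h)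
theorem d_SS (z) : lambda2d z ∈ SS := Submodule.mem_sup_right ⟨z, rfl⟩

theorem d00 (a b) : lambda2d (wdg (ej 0 a) (ej 0 b)) = 0 := by
  rw [d_wdg, c_e0, c_e0, wdg_neg_left, wdg_neg_right]; module
theorem d01 (a b) : lambda2d (wdg (ej 0 a) (ej 1 b)) = - wdg (ej 0 a) (ej 0 b) := by
  rw [d_wdg, c_e0, c_e1, wdg_neg_left, wdg_sub_right]; module

theorem S_self (a) : wdg (ej 0 a) (ej 1 a) ∈ SS := by
  apply ker_SS; rw [d01, wdg_self, neg_zero]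

theorem S_two (a b) : (2 : ℤ) • wdg (ej 0 a) (ej 1 b) ∈ SS := by
  have h1 : wdg (ej 0 a) (ej 1 b) + wdg (ej 0 b) (ej 1 a) ∈ SS := by
    apply ker_SS
    rw [map_add, d01, d01, wdg_swap (ej 0 a)]; module
  have h2 := d_SS (wdg (ej 1 a) (ej 1 b))
  have h3 := ker_SS (d00 a b)
  rw [d_wdg, c_e1, c_e1] at h2
  simp only [wdg_sub_left, wdg_sub_right] at h2
  rw [wdg_swap (ej 1 a) (ej 0 b)] at h2
  have := SS.add_mem (SS.sub_mem h1 h2) h3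
  convert this using 1
  module

theorem S_all (a b) : wdg (ej 0 a) (ej 1 b) ∈ SS := by
  rw [dec_spec a, dec_spec b]
  simp only [map_add, map_zsmul, wdg_add_left, wdg_add_right, wdg_zsmul_left, wdg_zsmul_right]
  simp only [smul_add]
  refine SS.add_mem (SS.add_mem ?_ ?_) (SS.add_mem ?_ ?_)
  · exact SS.smul_mem _ (SS.smul_mem _ (S_self 1))
  · first
    | exact SS.smul_mem _ (S_two _ _)
    | (rw [smul_comm]; exact SS.smul_mem _ (S_two _ _))
  · first
    | exact SS.smul_mem _ (S_two _ _)
    | (rw [smul_comm]; exact SS.smul_mem _ (S_two _ _))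
  · exact SS.smul_mem _ (S_two _ _)

theorem S_P (z) : z - exteriorPower.map 2 (ej 1) (PP z) ∈ SS := by
  refine wdg_induction (S := SS.comap (LinearMap.id - exteriorPower.map 2 (ej 1) ∘ₗ PP)) ?_ z
  intro x y
  rw [Submodule.mem_comap]
  simp only [LinearMap.sub_apply, LinearMap.id_apply, LinearMap.comp_apply, PP, map_wdg]
  simp only [pj, LinearMap.proj_apply]
  have e : wdg x y - wdg (ej 1 (x 1)) (ej 1 (y 1)) = wdg (ej 0 (x 0)) (ej 0 (y 0))
      + wdg (ej 0 (x 0)) (ej 1 (y 1)) - wdg (ej 0 (y 0)) (ej 1 (x 1)) := by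
    conv_lhs => rw [mm_eq x, mm_eq y]
    simp only [wdg_add_left, wdg_add_right]
    rw [wdg_swap (ej 1 (x 1)) (ej 0 (y 0))]
    simp [ej]
    module
  rw [e]
  exact SS.sub_mem (SS.add_mem (ker_SS (d00 _ _)) (S_all _ _)) (S_all _ _)

theorem PP_surj (z) : PP (exteriorPower.map 2 (ej 1) z) = z := by
  have : PP ∘ₗ exteriorPower.map 2 (ej 1) = LinearMap.id := by
    apply wdg_ext
    intro x y
    simp [PP, map_wdg, pj, ej]
  exact LinearMap.congr_fun this z

theorem gen_equiv {X Y : Type} [AddCommGroup X] [AddCommGroup Y] (d : X →ₗ[ℤ] X) (P : X →ₗ[ℤ] Y)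
    (hd : ∀ z, P (d z) = 0) (hk : ∀ z, d z = 0 → P z = 0) (hs : Function.Surjective P)
    (hS : ∀ z, P z = 0 → z ∈ LinearMap.ker d ⊔ LinearMap.range d) :
    Nonempty (((X ⧸ LinearMap.range d) ⧸
      LinearMap.range ((LinearMap.range d).mkQ.domRestrict (LinearMap.ker d))) ≃ₗ[ℤ] Y) := by
  let f1 := (LinearMap.range d).liftQ P (by
    rintro _ ⟨z, rfl⟩
    exact hd z)
  let f2 := (LinearMap.range ((LinearMap.range d).mkQ.domRestrict (LinearMap.ker d))).liftQ f1 (by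
    rintro _ ⟨⟨z, hz⟩, rfl⟩
    exact hk z hz)
  refine ⟨LinearEquiv.ofBijective f2 ⟨?_, ?_⟩⟩
  · rw [injective_iff_map_eq_zero]
    intro q hq
    obtain ⟨q, rfl⟩ := Submodule.mkQ_surjective _ q
    obtain ⟨z, rfl⟩ := Submodule.mkQ_surjective _ q
    have hz : P z = 0 := hq
    obtain ⟨k, hk, _, ⟨w, rfl⟩, rfl⟩ := Submodule.mem_sup.1 (hS z hz)
    rw [Submodule.mkQ_apply, Submodule.Quotient.mk_eq_zero]
    refine ⟨⟨k, hk⟩, ?_⟩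
    have : (LinearMap.range d).mkQ (d w) = 0 := by
      rw [Submodule.mkQ_apply, Submodule.Quotient.mk_eq_zero]
      exact ⟨w, rfl⟩
    rw [map_add, this, add_zero]
    rfl
  · intro y
    obtain ⟨z, rfl⟩ := hs y
    exact ⟨Submodule.mkQ _ (Submodule.mkQ _ z), rfl⟩

/-- Let `M̂ = ℤ₂²` with the automorphism `c` given by the matrix `[[-1, 1], [0, -1]]`.
Then the cokernel of the natural map from the invariants `(Λ²M̂)^C = ker (Λ²c - 1)` to
the coinvariants `(Λ²M̂)_C = coker (Λ²c - 1)` is isomorphic to `Λ²ℤ₂`, the exterior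
square over `ℤ` of the `2`-adic integers. -/
theorem stmt_17 :
    Nonempty
      (((((⋀[ℤ]^2 (Fin 2 → ℤ_[2])) : Submodule ℤ _) ⧸ LinearMap.range lambda2d) ⧸
          LinearMap.range invToCoinv) ≃ₗ[ℤ] ⋀[ℤ]^2 ℤ_[2]) := by
  
  have h := gen_equiv lambda2d PP (fun z => LinearMap.congr_fun PP_d z) PP_ker
    (fun z => ⟨_, PP_surj z⟩) (fun z hz => by
      have hS := S_P z
      rw [hz, map_zero, sub_zero] at hS
      exact hS)
  exact h
end
end

section
/- For any prime p and any n ≥ 2, the map of n-th exterior powers over ℤ, Λⁿ(ℤ_p) → Λⁿ(ℚ_p), induced by the inclusion ℤ_p ↪ ℚ_p, is an isomorphism of abelian groups. In particular, Λⁿ(ℤ_p) is p-divisible and is a ℚ-vector space. -/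
noncomputable section

/-- The `ℤ`-linear map `Λⁿ(ℤ_p) → Λⁿ(ℚ_p)` induced on `n`-th exterior powers over `ℤ`
by the inclusion `ℤ_p ↪ ℚ_p`. -/
def lambdaIncl (p : ℕ) [Fact p.Prime] (n : ℕ) :
    (⋀[ℤ]^n ℤ_[p]) →ₗ[ℤ] ⋀[ℤ]^n ℚ_[p] :=
  (ExteriorAlgebra.map
    ((PadicInt.Coe.ringHom (p := p)).toAddMonoidHom.toIntLinearMap)).toLinearMap.restrict
    (p := ⋀[ℤ]^n ℤ_[p]) (q := ⋀[ℤ]^n ℚ_[p])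
    (exmap_mem ((PadicInt.Coe.ringHom (p := p)).toAddMonoidHom.toIntLinearMap) n)

namespace LambdaAux

open Function

variable {M N E : Type} [AddCommGroup M] [AddCommGroup N] [AddCommGroup E]

/-- Descent of an alternating map along a surjection. -/
theorem descend {n : ℕ} (f : M [⋀^Fin n]→ₗ[ℤ] E) (π : M →ₗ[ℤ] N) (hπ : Surjective π)
    (h0 : ∀ (x : Fin n → M) (i : Fin n), π (x i) = 0 → f x = 0) :
    ∃ g : N [⋀^Fin n]→ₗ[ℤ] E, ∀ x, g (fun i => π (x i)) = f x := by
  classical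
  have hupd : ∀ (x : Fin n → M) (i : Fin n) (a b : M), π a = π b →
      f (update x i a) = f (update x i b) := by
    intro x i a b hab
    rw [← sub_eq_zero, ← AlternatingMap.map_update_sub]
    apply h0 _ i
    simp [hab]
  have hall : ∀ x y : Fin n → M, (∀ i, π (x i) = π (y i)) → f x = f y := by
    intro x y hxy
    have key : ∀ s : Finset (Fin n), f (s.piecewise x y) = f y := by
      intro s
      induction s using Finset.induction_on with
      | empty => simp
      | insert i s hi ih =>
        rw [Finset.piecewise_insert, hupd _ i (x i) ((s.piecewise x y) i), update_eq_self, ih]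
        rw [Finset.piecewise_eq_of_notMem _ _ _ hi, hxy]
    simpa using key Finset.univ
  choose s hs using hπ
  refine ⟨{ toFun := fun x => f (fun i => s (x i))
            map_update_add' := ?_
            map_update_smul' := ?_
            map_eq_zero_of_eq' := ?_ }, ?_⟩
  · intro inst x i a b
    obtain rfl : inst = instDecidableEqFin n := Subsingleton.elim _ _
    have hc : ∀ (c : M) (d : N), π c = d → f (fun k => s (update x i d k))
        = f (update (fun k => s (x k)) i c) := by
      intro c d hcd
      apply hall
      intro k
      by_cases hk : k = i
      · subst hk; simp [hs, hcd]
      · simp [hk]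
    rw [hc (s a + s b) (a + b) (by simp [hs]), hc (s a) a (hs a), hc (s b) b (hs b)]
    simp
  · intro inst x i c a
    obtain rfl : inst = instDecidableEqFin n := Subsingleton.elim _ _
    have hc : ∀ (c : M) (d : N), π c = d → f (fun k => s (update x i d k))
        = f (update (fun k => s (x k)) i c) := by
      intro c d hcd
      apply hall
      intro k
      by_cases hk : k = i
      · subst hk; simp [hs, hcd]
      · simp [hk]
    rw [hc (c • s a) (c • a) (by simp [hs]), hc (s a) a (hs a)]
    simp
  · intro v i j hij hne
    exact f.map_eq_zero_of_eq _ (by simp [hij]) hne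
  · intro x
    exact hall _ _ fun i => hs _

/-- Two alternating maps agreeing on tuples from a spanning set agree. -/
theorem alt_ext {n : ℕ} (f g : M [⋀^Fin n]→ₗ[ℤ] E) (S : Set M) (hS : Submodule.span ℤ S = ⊤)
    (h : ∀ x : Fin n → M, (∀ i, x i ∈ S) → f x = g x) : f = g := by
  apply exteriorPower.alternatingMapLinearEquiv.injective
  have hsp := exteriorPower.ιMulti_span_of_span ℤ n M hS
  apply LinearMap.ext_on hsp
  rintro _ ⟨a, ha, rfl⟩
  simpa using h a (fun i => ha ⟨i, rfl⟩)

/-- contraction part -/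
def D (m : ℕ) (e : M) : (ℤ × M) [⋀^Fin (m + 2)]→ₗ[ℤ] ⋀[ℤ]^(m + 2) M :=
  AlternatingMap.alternatizeUncurryFin
    ((LinearMap.fst ℤ ℤ M).smulRight
      (((exteriorPower.ιMulti ℤ (m + 2) (M := M)).curryLeft e).compLinearMap (LinearMap.snd ℤ ℤ M)))

theorem D_apply (m : ℕ) (e : M) (x : Fin (m + 2) → ℤ × M) :
    D m e x = ∑ i, (x i).1 • exteriorPower.ιMulti ℤ (m + 2) (update (fun k => (x k).2) i e) := by
  rw [D, AlternatingMap.alternatizeUncurryFin_apply]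
  refine Finset.sum_congr rfl fun i _ => ?_
  have : update (fun k => (x k).2) i e = i.insertNth e (i.removeNth (fun k => (x k).2)) := by
    simp
  rw [this, AlternatingMap.map_insertNth, smul_comm]
  simp
  rfl

def F (m : ℕ) (p : ℤ) (e : M) : (ℤ × M) [⋀^Fin (m + 2)]→ₗ[ℤ] ⋀[ℤ]^(m + 2) M :=
  p ^ (m + 1) • (exteriorPower.ιMulti ℤ (m + 2)).compLinearMap (LinearMap.snd ℤ ℤ M)
    + p ^ m • D m e

def proj (p : ℤ) (e : M) : ℤ × M →ₗ[ℤ] M :=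
  (LinearMap.fst ℤ ℤ M).smulRight e + p • LinearMap.snd ℤ ℤ M

theorem F_apply (m : ℕ) (p : ℤ) (e : M) (x : Fin (m + 2) → ℤ × M) :
    F m p e x = p ^ (m + 1) • exteriorPower.ιMulti ℤ (m + 2) (fun k => (x k).2)
      + p ^ m • ∑ i, (x i).1 • exteriorPower.ιMulti ℤ (m + 2) (update (fun k => (x k).2) i e) := by
  rw [← D_apply]; rfl

theorem F_zero (m : ℕ) (p : ℤ) (e : M) 
    (x : Fin (m + 2) → ℤ × M) (i : Fin (m + 2)) (k : ℤ) (h1 : (x i).1 = p * k)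
    (h2 : (x i).2 = -(k • e)) : F m p e x = 0 := by
  rw [F_apply, Finset.sum_eq_single i]
  · have : (fun k => (x k).2) = update (fun k => (x k).2) i ((-k) • e) := by
      rw [eq_comm, update_eq_self_iff, h2]; simp
    rw [this, AlternatingMap.map_update_smul, update_idem, h1]
    simp only [smul_smul, ← add_smul]
    convert zero_smul ℤ _ using 2
    ring
  · intro j _ hj
    have : update (fun k => (x k).2) j e = update (update (fun k => (x k).2) j e) i ((-k) • e) := by
      rw [eq_comm, update_eq_self_iff, update_of_ne hj.symm, h2]; simp
    rw [this, AlternatingMap.map_update_smul,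
      AlternatingMap.map_eq_zero_of_eq _ _ (i := i) (j := j), smul_zero, smul_zero]
    · simp [hj]
    · exact hj.symm
  · simp

theorem F_smul (m : ℕ) (p : ℤ) (e : M) :
    p • F m p e = (exteriorPower.ιMulti ℤ (m + 2)).compLinearMap (proj p e) := by
  apply alt_ext _ _ (insert ((1 : ℤ), (0 : M)) (Set.range (fun y : M => ((0 : ℤ), y))))
  · rw [eq_top_iff]
    rintro ⟨a, y⟩ -
    have : ((a, y) : ℤ × M) = a • (1, 0) + (0, y) := by simp
    rw [this]
    refine Submodule.add_mem _ (Submodule.smul_mem _ _ (Submodule.subset_span (by simp)))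
      (Submodule.subset_span (by simp))
  intro x hx
  by_cases hinj : Injective x
  swap
  · rw [AlternatingMap.map_eq_zero_of_not_injective _ _ hinj,
      AlternatingMap.map_eq_zero_of_not_injective _ _ hinj]
  have hx' : ∀ i, x i = (1, 0) ∨ (x i).1 = 0 := by
    intro i
    rcases hx i with h | ⟨y, hy⟩
    · exact Or.inl h
    · right; rw [← hy]
  rw [AlternatingMap.smul_apply, F_apply]
  by_cases hone : ∃ i, x i = (1, 0)
  · obtain ⟨i, hi⟩ := hone
    have hne : ∀ j, j ≠ i → (x j).1 = 0 := by
      intro j hj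
      rcases hx' j with h | h
      · exact absurd (hinj (h.trans hi.symm)) hj
      · exact h
    rw [AlternatingMap.map_coord_zero _ i (by simp [hi]), smul_zero, zero_add,
      Finset.sum_eq_single i (fun j _ hj => by rw [hne j hj, zero_smul]) (by simp)]
    rw [hi]
    have : (fun k => proj p e (x k)) = (fun k => (if k = i then (1 : ℤ) else p) •
        update (fun k => (x k).2) i e k) := by
      funext k
      by_cases hk : k = i
      · subst hk; simp [proj, hi]
      · simp [proj, hk, hne k hk]
    rw [AlternatingMap.compLinearMap_apply]
    erw [this]
    rw [AlternatingMap.map_smul_univ, Finset.prod_ite]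
    simp [smul_smul, ← pow_succ', Finset.filter_ne', Finset.card_erase_of_mem]
  · push Not at hone
    have hz : ∀ i, (x i).1 = 0 := fun i => (hx' i).resolve_left (hone i)
    simp only [hz, zero_smul, Finset.sum_const_zero, smul_zero, add_zero]
    rw [AlternatingMap.compLinearMap_apply]
    have : (fun k => proj p e (x k)) = (fun k => p • (x k).2) := by
      funext k; simp [proj, hz]
    erw [this]
    rw [AlternatingMap.map_smul_univ]
    simp [smul_smul, ← pow_succ']

theorem bij_p (m : ℕ) (p : ℤ) (e : M) (hs : ∀ x : M, ∃ (a : ℤ) (y : M), x = a • e + p • y)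
    (hk : ∀ (a : ℤ) (y : M), a • e + p • y = 0 → ∃ k : ℤ, a = p * k ∧ y = -(k • e)) :
    Bijective (fun x : ⋀[ℤ]^(m + 2) M => p • x) := by
  obtain ⟨g, hg⟩ := descend (F m p e) (proj p e)
    (fun x => by obtain ⟨a, y, h⟩ := hs x; exact ⟨(a, y), by simp [proj, h]⟩)
    (fun x i h => by
      obtain ⟨k, h1, h2⟩ := hk (x i).1 (x i).2 (by simpa [proj] using h)
      exact F_zero m p e x i k h1 h2)
  have hsurj : Surjective (proj p e) := fun x => by
    obtain ⟨a, y, h⟩ := hs x; exact ⟨(a, y), by simp [proj, h]⟩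
  have key : p • exteriorPower.alternatingMapLinearEquiv g = LinearMap.id := by
    apply exteriorPower.linearMap_ext
    ext1 v
    choose w hw using fun i => hsurj (v i)
    obtain rfl : (fun i => proj p e (w i)) = v := funext hw
    have h2 := congrArg (fun f => f w) (F_smul m p e)
    simp only [LinearMap.compAlternatingMap_apply, LinearMap.smul_apply,
      exteriorPower.alternatingMapLinearEquiv_apply_ιMulti, hg, LinearMap.id_apply]
    exact h2
  have key' : ∀ x, p • exteriorPower.alternatingMapLinearEquiv g x = x := fun x =>
    congrArg (fun f => f x) key
  refine ⟨?_, fun x => ⟨_, key' x⟩⟩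
  intro x y hxy
  rw [← key' x, ← key' y, ← map_smul, ← map_smul]
  exact congrArg _ hxy

theorem bij_unit (n : ℕ) (hn : 1 ≤ n) (q : ℤ) (h : Bijective (fun x : M => q • x)) :
    Bijective (fun x : ⋀[ℤ]^n M => q • x) := by
  obtain ⟨n, rfl⟩ : ∃ k, n = k + 1 := ⟨n - 1, by omega⟩
  let u : M ≃ₗ[ℤ] M := LinearEquiv.ofBijective (q • LinearMap.id) h
  have hu : ∀ x, u x = q • x := fun x => rfl
  let r := exteriorPower.map (n + 1) u.symm.toLinearMap
  have key : q ^ (n + 1) • r = LinearMap.id := by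
    apply exteriorPower.linearMap_ext
    ext1 v
    simp only [LinearMap.compAlternatingMap_apply, LinearMap.smul_apply, r,
      exteriorPower.map_apply_ιMulti, LinearMap.id_apply]
    have h1 := AlternatingMap.map_smul_univ (exteriorPower.ιMulti ℤ (n + 1) (M := M))
      (fun _ => q) (u.symm.toLinearMap ∘ v)
    simp only [Finset.prod_const, Finset.card_univ, Fintype.card_fin] at h1
    rw [← h1]
    congr 1
    funext i
    rw [← hu]
    simp
  have key' : ∀ x, q • (q ^ n • r x) = x := fun x => by
    rw [smul_smul, ← pow_succ']
    exact congrArg (fun f => f x) key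
  refine ⟨?_, fun x => ⟨_, key' x⟩⟩
  intro x y hxy
  have hr : ∀ z, q • (q ^ n • r z) = q ^ n • r (q • z) := fun z => by
    rw [smul_comm q, map_smul]
  rw [← key' x, ← key' y, hr, hr]
  exact congrArg (fun z => q ^ n • r z) hxy

theorem bij_pow (p : ℤ) (h : Bijective (fun x : E => p • x)) (k : ℕ) :
    Bijective (fun x : E => p ^ k • x) := by
  induction k with
  | zero => simp only [pow_zero, one_smul]; exact bijective_id
  | succ k ih =>
    have := h.comp ih
    simpa [Function.comp_def, smul_smul, pow_succ'] using this

theorem map_bij (n : ℕ) (p : ℤ) (j : M →ₗ[ℤ] N) (hj : Injective j)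
    (hN : Bijective (fun x : N => p • x))
    (hloc : ∀ x : N, ∃ (k : ℕ) (y : M), j y = p ^ k • x)
    (hM : Bijective (fun x : ⋀[ℤ]^n M => p • x))
    (hE : Bijective (fun x : ⋀[ℤ]^n N => p • x)) :
    Bijective (exteriorPower.map n j) := by
  have hsc : ∀ (c : ℤ) (w : Fin n → M), exteriorPower.ιMulti ℤ n (fun i => c • w i)
      = c ^ n • exteriorPower.ιMulti ℤ n w := by
    intro c w
    rw [AlternatingMap.map_smul_univ _ (fun _ => c)]; simp
  have hsc' : ∀ (c : ℤ) (w : Fin n → N), exteriorPower.ιMulti ℤ n (fun i => c • w i)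
      = c ^ n • exteriorPower.ιMulti ℤ n w := by
    intro c w
    rw [AlternatingMap.map_smul_univ _ (fun _ => c)]; simp
  have hMk := bij_pow p hM
  have hEk := bij_pow p hE
  -- common denominators
  have hcd1 : ∀ x : N, ∃ k : ℕ, ∀ l, k ≤ l → ∃ y : M, j y = p ^ l • x := by
    intro x
    obtain ⟨k, y, hy⟩ := hloc x
    refine ⟨k, fun l hl => ⟨p ^ (l - k) • y, ?_⟩⟩
    rw [map_smul, hy, smul_smul, ← pow_add, Nat.sub_add_cancel hl]
  have hcd : ∀ v : Fin n → N, ∃ k : ℕ, ∀ l, k ≤ l → ∃ w : Fin n → M, ∀ i, j (w i) = p ^ l • v i := by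
    intro v
    choose k hk using fun i => hcd1 (v i)
    refine ⟨Finset.univ.sup k, fun l hl => ?_⟩
    choose w hw using fun i => hk i l ((Finset.le_sup (Finset.mem_univ i)).trans hl)
    exact ⟨w, hw⟩
  have hex : ∀ v : Fin n → N, ∃ e : ⋀[ℤ]^n M, ∀ (k : ℕ) (w : Fin n → M),
      (∀ i, j (w i) = p ^ k • v i) → (p ^ k) ^ n • e = exteriorPower.ιMulti ℤ n w := by
    intro v
    obtain ⟨K, hK⟩ := hcd v
    obtain ⟨W, hW⟩ := hK K le_rfl
    obtain ⟨e, he⟩ := (hMk (K * n)).2 (exteriorPower.ιMulti ℤ n W)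
    refine ⟨e, fun k w hw => ?_⟩
    apply (hMk (K * n)).1
    simp only at he ⊢
    rw [smul_comm, he, pow_mul, ← hsc, ← hsc]
    congr 1
    funext i
    apply hj
    rw [map_smul, map_smul, hw, hW, smul_comm]
  choose ψ hψ using hex
  have huniq : ∀ (k : ℕ) (a b : ⋀[ℤ]^n M), (p ^ k) ^ n • a = (p ^ k) ^ n • b → a = b := by
    intro k a b h
    rw [← pow_mul] at h
    exact (hMk (k * n)).1 h
  have hupd : ∀ (k : ℕ) (x : Fin n → N) (w : Fin n → M) (i : Fin n) (a : N) (y : M),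
      (∀ i, j (w i) = p ^ k • x i) → j y = p ^ k • a →
      (p ^ k) ^ n • ψ (update x i a) = exteriorPower.ιMulti ℤ n (update w i y) := by
    intro k x w i a y hw hy
    apply hψ
    intro l
    by_cases hl : l = i
    · subst hl; simp [hy]
    · simp [hl, hw]
  let g : N [⋀^Fin n]→ₗ[ℤ] ⋀[ℤ]^n M :=
    { toFun := ψ
      map_update_add' := by
        intro inst x i a b
        obtain rfl : inst = instDecidableEqFin n := Subsingleton.elim _ _
        obtain ⟨k0, hk0⟩ := hcd x
        obtain ⟨k1, hk1⟩ := hcd1 a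
        obtain ⟨k2, hk2⟩ := hcd1 b
        obtain ⟨w, hw⟩ := hk0 (k0 + k1 + k2) (by omega)
        obtain ⟨y, hy⟩ := hk1 (k0 + k1 + k2) (by omega)
        obtain ⟨z, hz⟩ := hk2 (k0 + k1 + k2) (by omega)
        apply huniq (k0 + k1 + k2)
        rw [smul_add, hupd _ x w i _ _ hw hy, hupd _ x w i _ _ hw hz,
          hupd _ x w i (a + b) (y + z) hw (by rw [map_add, hy, hz, smul_add])]
        simp
      map_update_smul' := by
        intro inst x i c a
        obtain rfl : inst = instDecidableEqFin n := Subsingleton.elim _ _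
        obtain ⟨k0, hk0⟩ := hcd x
        obtain ⟨k1, hk1⟩ := hcd1 a
        obtain ⟨w, hw⟩ := hk0 (k0 + k1) (by omega)
        obtain ⟨y, hy⟩ := hk1 (k0 + k1) (by omega)
        apply huniq (k0 + k1)
        rw [smul_comm _ c, hupd _ x w i _ _ hw hy,
          hupd _ x w i (c • a) (c • y) hw (by rw [map_smul, hy, smul_comm])]
        simp
      map_eq_zero_of_eq' := by
        intro v i l hv hil
        obtain ⟨k, hk⟩ := hcd v
        obtain ⟨w, hw⟩ := hk k le_rfl
        apply huniq k
        rw [hψ v k w hw, smul_zero]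
        exact AlternatingMap.map_eq_zero_of_eq _ _ (hj (by rw [hw, hw, hv])) hil }
  have hg : ∀ v, g v = ψ v := fun v => rfl
  constructor
  · have : (exteriorPower.alternatingMapLinearEquiv g) ∘ₗ (exteriorPower.map n j)
        = LinearMap.id := by
      apply exteriorPower.linearMap_ext
      ext1 v
      simp only [LinearMap.compAlternatingMap_apply, LinearMap.comp_apply,
        exteriorPower.map_apply_ιMulti, exteriorPower.alternatingMapLinearEquiv_apply_ιMulti,
        LinearMap.id_apply, hg]
      have := hψ (j ∘ v) 0 v (by simp)
      simpa using this
    intro x y hxy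
    have h := fun z => congrArg (fun f => f z) this
    simp only [LinearMap.comp_apply, LinearMap.id_apply] at h
    rw [← h x, ← h y, hxy]
  · rw [← LinearMap.range_eq_top, eq_top_iff, ← exteriorPower.ιMulti_span, Submodule.span_le]
    rintro _ ⟨v, rfl⟩
    refine ⟨ψ v, ?_⟩
    obtain ⟨k, hk⟩ := hcd v
    obtain ⟨w, hw⟩ := hk k le_rfl
    apply (hEk (k * n)).1
    simp only
    rw [← map_smul, pow_mul, hψ v k w hw, exteriorPower.map_apply_ιMulti, ← hsc']
    congr 1
    funext i
    exact hw i

theorem padic_bij_p (p : ℕ) [Fact p.Prime] (m : ℕ) :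
    Bijective (fun x : ⋀[ℤ]^(m + 2) ℤ_[p] => (p : ℤ) • x) := by
  have hp0 : (p : ℤ_[p]) ≠ 0 := by exact_mod_cast (Fact.out : p.Prime).ne_zero
  apply bij_p m (p : ℤ) (1 : ℤ_[p])
  · intro x
    have h := PadicInt.appr_spec 1 x
    rw [pow_one, Ideal.mem_span_singleton] at h
    obtain ⟨y, hy⟩ := h
    refine ⟨(x.appr 1 : ℤ), y, ?_⟩
    simp only [zsmul_eq_mul]
    push_cast
    linear_combination hy
  · intro a y h
    simp only [zsmul_eq_mul] at h
    push_cast at h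
    have hd : (p : ℤ) ∣ a := by
      rw [← PadicInt.norm_int_lt_one_iff_dvd, PadicInt.norm_lt_one_iff_dvd]
      exact ⟨-y, by linear_combination h⟩
    obtain ⟨k, rfl⟩ := hd
    refine ⟨k, rfl, ?_⟩
    apply mul_left_cancel₀ hp0
    simp only [zsmul_eq_mul]
    push_cast at h
    linear_combination h

theorem padic_bij_unit (p : ℕ) [Fact p.Prime] (m : ℕ) (q : ℤ) (hq : ¬ (p : ℤ) ∣ q) :
    Bijective (fun x : ⋀[ℤ]^(m + 2) ℤ_[p] => q • x) := by
  apply bij_unit _ (by omega)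
  rw [← PadicInt.norm_int_lt_one_iff_dvd, ← PadicInt.not_isUnit_iff, not_not] at hq
  simp only [zsmul_eq_mul]
  exact IsUnit.isUnit_iff_mulLeft_bijective.mp hq

theorem padic_bij (p : ℕ) [Fact p.Prime] (m : ℕ) (q : ℤ) (hq : q ≠ 0) :
    Bijective (fun x : ⋀[ℤ]^(m + 2) ℤ_[p] => q • x) := by
  have hp : Prime (p : ℤ) := Nat.prime_iff_prime_int.mp Fact.out
  have hfin : FiniteMultiplicity (p : ℤ) q := FiniteMultiplicity.of_prime_left hp hq
  obtain ⟨c, hc, hnd⟩ := hfin.exists_eq_pow_mul_and_not_dvd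
  have := (bij_pow _ (padic_bij_p p m) (multiplicity (p : ℤ) q)).comp (padic_bij_unit p m c hnd)
  rw [hc]
  simpa [Function.comp_def, smul_smul, ← hc] using this

end LambdaAux

/-- For any prime `p` and any `n ≥ 2` the map of `n`-th exterior powers over `ℤ`
induced by the inclusion `ℤ_p ↪ ℚ_p` is an isomorphism of abelian groups.  In
particular `Λⁿ(ℤ_p)` is `p`-divisible and is a `ℚ`-vector space (it is uniquely
divisible). -/
theorem stmt_19 (p : ℕ) [Fact p.Prime] (n : ℕ) (hn : 2 ≤ n) :
    Function.Bijective (lambdaIncl p n) ∧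
    (∀ x : ⋀[ℤ]^n ℤ_[p], ∃ y : ⋀[ℤ]^n ℤ_[p], (p : ℤ) • y = x) ∧
    (∀ q : ℤ, q ≠ 0 → ∀ x : ⋀[ℤ]^n ℤ_[p], ∃! y : ⋀[ℤ]^n ℤ_[p], q • y = x) := by
  obtain ⟨m, rfl⟩ : ∃ m, n = m + 2 := ⟨n - 2, by omega⟩
  refine ⟨?_, (LambdaAux.padic_bij_p p m).2, fun q hq x => ?_⟩
  · have hp0 : (p : ℚ_[p]) ≠ 0 := by exact_mod_cast (Fact.out : p.Prime).ne_zero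
    have hN : Function.Bijective (fun x : ℚ_[p] => (p : ℤ) • x) := by
      simp only [zsmul_eq_mul, Int.cast_natCast]
      exact mulLeft_bijective₀ _ hp0
    have h := LambdaAux.map_bij (m + 2) (p : ℤ)
      ((PadicInt.Coe.ringHom (p := p)).toAddMonoidHom.toIntLinearMap)
      (fun x y h => Subtype.ext h) hN ?_ (LambdaAux.padic_bij_p p m)
      (LambdaAux.bij_unit _ (by omega) _ hN)
    · have heq : lambdaIncl p (m + 2) = exteriorPower.map (m + 2)
          ((PadicInt.Coe.ringHom (p := p)).toAddMonoidHom.toIntLinearMap) := by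
        apply exteriorPower.linearMap_ext
        ext1 v
        apply Subtype.ext
        simp only [LinearMap.compAlternatingMap_apply, exteriorPower.map_apply_ιMulti]
        exact ExteriorAlgebra.map_apply_ιMulti _ _
      rw [heq]
      exact h
    · intro x
      obtain ⟨k, hk⟩ : ∃ k : ℕ, ‖(p : ℚ_[p]) ^ k * x‖ ≤ 1 := by
        have hlt : ‖(p : ℚ_[p])‖ < 1 := Padic.norm_p_lt_one
        have ht : Filter.Tendsto (fun k : ℕ => ‖(p : ℚ_[p]) ^ k * x‖) Filter.atTop (nhds 0) := by
          have := (tendsto_pow_atTop_nhds_zero_of_lt_one (norm_nonneg _) hlt).mul_const ‖x‖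
          simpa using this
        exact (ht.eventually (ge_mem_nhds one_pos)).exists
      refine ⟨k, ⟨_, hk⟩, ?_⟩
      rw [zsmul_eq_mul]
      push_cast
      rfl
  · obtain ⟨y, hy⟩ := (LambdaAux.padic_bij p m q hq).2 x
    exact ⟨y, hy, fun z hz => (LambdaAux.padic_bij p m q hq).1 (hz.trans hy.symm)⟩
end
end
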